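/- arXiv:2207.11473 — 4 statements merged into one kernel-verified Lean document; each statement's English description precedes it below -/
import Mathlib

section
/- (Anosov's theorem) Let n ≥ 3 and let f be a positive continuous probability density on ℝ. Let Φ = {φ = (φ_1,…,φ_{n−2}) : φ_j ∈ [0,π] for j = 1,…,n−3, φ_{n−2} ∈ [0,2π]}. Let T be a nonnegative continuous function on Φ with 0 < ∫_Φ T(φ) dφ < ∞, and let σ_1,…,σ_n be continuous functions on Φ satisfying ∑_{j=1}^n σ_j(φ) = 0 and 0 < ∑_{j=1}^n σ_j(φ)² < ∞ for all φ ∈ Φ. If there is a constant c > 0 such that ∫_Φ ∏_{j=1}^n f(x + s σ_j(φ)) T(φ) dφ = c (f(x))^n ∫_Φ ∏_{j=1}^n f(s σ_j(φ)) T(φ) dφ for all x ∈ ℝ and all s ≥ 0, then f is a normal density, i.e. f(x) = (1/(σ√(2π))) exp(−(x−μ)²/(2σ²)) for some μ ∈ ℝ and σ > 0. -/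
open MeasureTheory ProbabilityTheory Real

/-- The torus `Φ ⊂ ℝ^{n-2}`: the first `n-3` coordinates range over `[0, π]`,
the last one over `[0, 2π]`. -/
noncomputable def PhiSet (n : ℕ) : Set (Fin (n - 2) → ℝ) :=
  {φ | ∀ j : Fin (n - 2),
    ((j : ℕ) + 1 < n - 2 → φ j ∈ Set.Icc 0 π) ∧
    ((j : ℕ) + 1 = n - 2 → φ j ∈ Set.Icc 0 (2 * π))}

open Set Filter Topology

/-- The graph of `h` is touched from above, at some point, by a parabola with leading
coefficient `a`. -/
def ParabolaTouchesAbove (h : ℝ → ℝ) (a : ℝ) : Prop :=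
  ∃ x b, ∀ᶠ y in 𝓝 (0 : ℝ), h (x + y) ≤ h x + b * y + a * y ^ 2

lemma parabolaTouchesAbove_of_chord_lt {h : ℝ → ℝ} (hh : Continuous h) {a p m q : ℝ}
    (hpm : p < m) (hmq : m < q)
    (hlt : h p * (q - m) + h q * (m - p) < h m * (q - p) + a * ((q - p) * (q - m) * (m - p))) :
    ParabolaTouchesAbove h a := by
  set w : ℝ → ℝ := fun x ↦
    h x * (q - p) - h p * (q - x) - h q * (x - p) + a * ((q - p) * (q - x) * (x - p)) with hw
  have hwc : Continuous w := by fun_prop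
  obtain ⟨x, hx, hmax⟩ := isCompact_Icc.exists_isMaxOn
    (nonempty_Icc.2 (hpm.trans hmq).le) hwc.continuousOn
  have hwm : 0 < w m := by simp only [hw]; linarith
  have hwx : 0 < w x := hwm.trans_le (hmax ⟨hpm.le, hmq.le⟩)
  have hxp : p ≠ x := by rintro rfl; simp [hw] at hwx
  have hxq : x ≠ q := by rintro rfl; simp [hw] at hwx
  have hnhds : ∀ᶠ y in 𝓝 (0 : ℝ), x + y ∈ Icc p q := by
    have : Tendsto (fun y : ℝ ↦ x + y) (𝓝 0) (𝓝 x) := by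
      simpa using (continuous_const_add x).tendsto (0 : ℝ)
    exact this (Icc_mem_nhds (lt_of_le_of_ne hx.1 hxp) (lt_of_le_of_ne hx.2 hxq))
  have hd : 0 < q - p := by linarith
  refine ⟨x, (h q - h p) / (q - p) - a * (q + p - 2 * x), hnhds.mono fun y hy ↦ ?_⟩
  have h1 : w (x + y) ≤ w x := hmax hy
  have h2 : (h q - h p) / (q - p) * (q - p) = h q - h p := div_mul_cancel₀ _ hd.ne'
  refine le_of_mul_le_mul_right ?_ hd
  simp only [hw] at h1
  linear_combination h1 - y * h2

/-- A continuous function is quadratic if no parabola touching it from above is less convex than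
one touching it from below. -/
lemma exists_quadratic_of_parabolaTouchesAbove {h : ℝ → ℝ} (hh : Continuous h)
    (hcmp : ∀ a b, ParabolaTouchesAbove h a → ParabolaTouchesAbove (-h) (-b) → b ≤ a) :
    ∃ a b c, ∀ x, h x = a * x ^ 2 + b * x + c := by
  have above : ∀ {a p m q : ℝ}, p < m → m < q →
      h p * (q - m) + h q * (m - p) < h m * (q - p) + a * ((q - p) * (q - m) * (m - p)) →
      ParabolaTouchesAbove h a := parabolaTouchesAbove_of_chord_lt hh
  have below : ∀ {a p m q : ℝ}, p < m → m < q →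
      h m * (q - p) + a * ((q - p) * (q - m) * (m - p)) < h p * (q - m) + h q * (m - p) →
      ParabolaTouchesAbove (-h) (-a) := fun hpm hmq hlt ↦
    parabolaTouchesAbove_of_chord_lt hh.neg hpm hmq (by simp only [Pi.neg_apply]; linarith)
  obtain ⟨a, ha⟩ : ∃ a, a = (h 1 + h (-1)) / 2 - h 0 := ⟨_, rfl⟩
  have le_above : ∀ a', ParabolaTouchesAbove h a' → a ≤ a' := fun a' ha' ↦
    le_of_forall_lt fun b hb ↦ by
      have := hcmp a' ((a + b) / 2) ha'
        (below (p := -1) (m := 0) (q := 1) (by norm_num) (by norm_num) (by linarith))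
      linarith
  have below_le : ∀ b', ParabolaTouchesAbove (-h) (-b') → b' ≤ a := fun b' hb' ↦
    le_of_forall_gt fun b hb ↦ by
      have := hcmp ((a + b) / 2) b'
        (above (p := -1) (m := 0) (q := 1) (by norm_num) (by norm_num) (by linarith)) hb'
      linarith
  have key : ∀ {p m q : ℝ}, p < m → m < q →
      h p * (q - m) + h q * (m - p) = h m * (q - p) + a * ((q - p) * (q - m) * (m - p)) := by
    intro p m q hpm hmq
    have hd : 0 < (q - p) * (q - m) * (m - p) :=
      mul_pos (mul_pos (by linarith) (by linarith)) (by linarith)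
    set d := (q - p) * (q - m) * (m - p)
    obtain ⟨e, he⟩ : ∃ e, e * d =
        (h m * (q - p) + a * d - (h p * (q - m) + h q * (m - p))) / 2 :=
      ⟨_, div_mul_cancel₀ _ hd.ne'⟩
    rcases lt_trichotomy (h p * (q - m) + h q * (m - p)) (h m * (q - p) + a * d) with hlt | heq | hgt
    · have h1 := le_above (a - e) (above hpm hmq (by
        change _ < _ + (a - e) * d
        linarith))
      nlinarith
    · exact heq
    · have h1 := below_le (a - e) (below hpm hmq (by
        change _ + (a - e) * d < _
        linarith))
      nlinarith
  refine ⟨a, h 1 - h 0 - a, h 0, fun x ↦ ?_⟩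
  rcases lt_trichotomy x 0 with hx | rfl | hx
  · have := key hx zero_lt_one
    linear_combination this
  · ring
  · rcases lt_trichotomy x 1 with hx1 | rfl | hx1
    · have := key hx hx1
      linear_combination -this
    · ring
    · have := key zero_lt_one hx1
      linear_combination this

lemma isCompact_phiSet (n : ℕ) : IsCompact (PhiSet n) := by
  have : PhiSet n = Set.pi univ fun j : Fin (n - 2) ↦
      Icc 0 (if (j : ℕ) + 1 < n - 2 then π else 2 * π) := by
    ext φ
    simp only [PhiSet, Set.mem_ofPred_eq, Set.mem_pi, Set.mem_univ, true_imp_iff]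
    refine forall_congr' fun j ↦ ?_
    have hj := j.2
    split_ifs with hlt
    · simp [hlt, hlt.ne]
    · have : (j : ℕ) + 1 = n - 2 := by omega
      simp [this]
  rw [this]
  exact isCompact_univ_pi fun j ↦ isCompact_Icc

section Comparison

variable {X ι : Type*} [TopologicalSpace X] [T2Space X] [MeasurableSpace X]
  [OpensMeasurableSpace X] [Fintype ι] {ν : Measure X} {K : Set X} {T : X → ℝ} {σ : ι → X → ℝ}

/-- If weighted averages of `exp (∑ j, (h (x + s * σ j) - h x))` do not depend on `x`, then no
parabola touching `h` from above is less convex than one touching `h` from below. -/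
lemma le_of_parabolaTouchesAbove_of_setIntegral_eq [IsFiniteMeasureOnCompacts ν]
    (hK : IsCompact K) (hT : ContinuousOn T K) (hT0 : ∀ φ ∈ K, 0 ≤ T φ)
    (hTpos : 0 < ∫ φ in K, T φ ∂ν) (hσ : ∀ j, ContinuousOn (σ j) K)
    (hσ_sum : ∀ φ ∈ K, ∑ j, σ j φ = 0) (hσ_sq : ∀ φ ∈ K, 0 < ∑ j, σ j φ ^ 2)
    {h : ℝ → ℝ} (hh : Continuous h)
    (heq : ∀ s, 0 ≤ s → ∃ k, ∀ x, ∫ φ in K, exp (∑ j, (h (x + s * σ j φ) - h x)) * T φ ∂ν = k)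
    {a b : ℝ} (ha : ParabolaTouchesAbove h a) (hb : ParabolaTouchesAbove (-h) (-b)) :
    b ≤ a := by
  by_contra! hab
  obtain ⟨x, p, hx⟩ := ha
  obtain ⟨z, q, hz⟩ := hb
  obtain ⟨δ, hδ, hball⟩ := Metric.eventually_nhds_iff.1 (hx.and hz)
  obtain ⟨M, hM⟩ : ∃ M, ∀ φ ∈ K, ∀ j, |σ j φ| ≤ M := by
    choose C hC using fun j ↦ hK.exists_bound_of_continuousOn (hσ j)
    exact ⟨∑ j, |C j|, fun φ hφ j ↦ ((hC j φ hφ).trans (le_abs_self _)).trans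
      (Finset.single_le_sum (f := fun j ↦ |C j|) (fun _ _ ↦ abs_nonneg _) (Finset.mem_univ j))⟩
  obtain ⟨s, hs, hsM⟩ : ∃ s, 0 < s ∧ s * |M| < δ :=
    ⟨δ / (|M| + 1), by positivity, by
      rw [div_mul_eq_mul_div, div_lt_iff₀ (by positivity)]
      nlinarith⟩
  have hsmall : ∀ φ ∈ K, ∀ j, dist (s * σ j φ) 0 < δ := fun φ hφ j ↦ by
    rw [dist_zero_right, Real.norm_eq_abs, abs_mul, abs_of_pos hs]
    exact lt_of_le_of_lt
      (mul_le_mul_of_nonneg_left ((hM φ hφ j).trans (le_abs_self M)) hs.le) hsM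
  have hquad : ∀ φ ∈ K, ∀ r t : ℝ,
      ∑ j, (r * (s * σ j φ) + t * (s * σ j φ) ^ 2) = t * s ^ 2 * ∑ j, σ j φ ^ 2 := by
    intro φ hφ r t
    simp only [mul_pow, Finset.sum_add_distrib, ← Finset.mul_sum, hσ_sum φ hφ]
    ring
  have h_int : ∀ {g : X → ℝ}, ContinuousOn g K → IntegrableOn (fun φ ↦ exp (g φ) * T φ) K ν :=
    fun hg ↦ ((continuous_exp.comp_continuousOn hg).mul hT).integrableOn_compact hK
  have hc1 : ∀ x, ContinuousOn (fun φ ↦ ∑ j, (h (x + s * σ j φ) - h x)) K := fun x ↦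
    continuousOn_finsetSum _ fun j _ ↦ (hh.comp_continuousOn
      (continuousOn_const.add (continuousOn_const.mul (hσ j)))).sub continuousOn_const
  have hc2 : ∀ t : ℝ, ContinuousOn (fun φ ↦ t * s ^ 2 * ∑ j, σ j φ ^ 2) K := fun t ↦
    continuousOn_const.mul (continuousOn_finsetSum _ fun j _ ↦ (hσ j).pow 2)
  obtain ⟨k, hk⟩ := heq s hs.le
  have hka : k ≤ ∫ φ in K, exp (a * s ^ 2 * ∑ j, σ j φ ^ 2) * T φ ∂ν := by
    rw [← hk x]
    refine setIntegral_mono_on (h_int (hc1 x)) (h_int (hc2 a)) hK.measurableSet fun φ hφ ↦ ?_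
    refine mul_le_mul_of_nonneg_right (exp_le_exp.2 ?_) (hT0 φ hφ)
    rw [← hquad φ hφ p a]
    refine Finset.sum_le_sum fun j _ ↦ ?_
    linarith [(hball (hsmall φ hφ j)).1]
  have hkb : ∫ φ in K, exp (b * s ^ 2 * ∑ j, σ j φ ^ 2) * T φ ∂ν ≤ k := by
    rw [← hk z]
    refine setIntegral_mono_on (h_int (hc2 b)) (h_int (hc1 z)) hK.measurableSet fun φ hφ ↦ ?_
    refine mul_le_mul_of_nonneg_right (exp_le_exp.2 ?_) (hT0 φ hφ)
    rw [← hquad φ hφ (-q) b]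
    refine Finset.sum_le_sum fun j _ ↦ ?_
    have := (hball (hsmall φ hφ j)).2
    simp only [Pi.neg_apply] at this
    linarith
  have hlt : ∀ φ ∈ K, exp (a * s ^ 2 * ∑ j, σ j φ ^ 2) < exp (b * s ^ 2 * ∑ j, σ j φ ^ 2) :=
    fun φ hφ ↦ exp_lt_exp.2 (mul_lt_mul_of_pos_right
      (mul_lt_mul_of_pos_right hab (by positivity)) (hσ_sq φ hφ))
  have hsub := integral_sub (h_int (hc2 b)) (h_int (hc2 a))
  have hnonneg : ∀ φ ∈ K, 0 ≤ exp (b * s ^ 2 * ∑ j, σ j φ ^ 2) * T φ -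
      exp (a * s ^ 2 * ∑ j, σ j φ ^ 2) * T φ := fun φ hφ ↦
    sub_nonneg.2 (mul_le_mul_of_nonneg_right (hlt φ hφ).le (hT0 φ hφ))
  have hzero : ∫ φ in K, (exp (b * s ^ 2 * ∑ j, σ j φ ^ 2) * T φ -
      exp (a * s ^ 2 * ∑ j, σ j φ ^ 2) * T φ) ∂ν = 0 :=
    le_antisymm (by linarith) (setIntegral_nonneg hK.measurableSet hnonneg)
  have hae := (setIntegral_eq_zero_iff_of_nonneg_ae
    ((ae_restrict_iff' hK.measurableSet).2 (Eventually.of_forall hnonneg))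
    ((h_int (hc2 b)).sub (h_int (hc2 a)))).1 hzero
  refine hTpos.ne' (integral_eq_zero_of_ae ?_)
  filter_upwards [hae, ae_restrict_mem hK.measurableSet] with φ h0 hφ
  simp only [Pi.zero_apply, ← sub_mul] at h0 ⊢
  exact (mul_eq_zero.1 h0).resolve_left (sub_pos.2 (hlt φ hφ)).ne'

end Comparison

lemma neg_of_integrable_exp_quadratic {a b c : ℝ}
    (h_int : Integrable fun x : ℝ ↦ exp (a * x ^ 2 + b * x + c)) : a < 0 := by
  have hsymm : Integrable fun x : ℝ ↦ exp (-(-a) * x ^ 2) := by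
    refine ((h_int.add h_int.comp_neg).const_mul (exp (-c))).mono' (by fun_prop)
      (Eventually.of_forall fun x ↦ ?_)
    rw [Real.norm_of_nonneg (exp_pos _).le]
    simp only [Pi.add_apply, mul_add, ← exp_add]
    rcases le_total 0 (b * x) with hx | hx
    · refine le_add_of_le_of_nonneg (exp_le_exp.2 ?_) (exp_pos _).le
      linarith
    · refine le_add_of_nonneg_of_le (exp_pos _).le (exp_le_exp.2 ?_)
      linarith [neg_sq x]
  exact neg_pos.1 (integrable_exp_neg_mul_sq_iff.1 hsymm)

/-- A probability density whose logarithm is quadratic is a normal density. -/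
lemma exists_eq_normal_density_of_eq_exp_quadratic {f : ℝ → ℝ} (hf : ∫ x, f x = 1) {a b c : ℝ}
    (hq : ∀ x, f x = exp (a * x ^ 2 + b * x + c)) :
    ∃ μ σ₀ : ℝ, 0 < σ₀ ∧
      ∀ x, f x = (1 / (σ₀ * Real.sqrt (2 * π))) *
        Real.exp (-(x - μ) ^ 2 / (2 * σ₀ ^ 2)) := by
  have h_int : Integrable f := by
    by_contra hn
    simp [integral_undef hn] at hf
  have ha : a < 0 := neg_of_integrable_exp_quadratic (a := a) (b := b) (c := c)
    (h_int.congr (Eventually.of_forall hq))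
  obtain ⟨s, hs, has⟩ : ∃ s : ℝ, 0 < s ∧ a = -1 / (2 * s ^ 2) := by
    refine ⟨√(1 / (-2 * a)), Real.sqrt_pos.2 (one_div_pos.2 (by linarith)), ?_⟩
    rw [Real.sq_sqrt (one_div_pos.2 (by linarith)).le]
    field_simp
  set μ := b * s ^ 2
  set C := exp (c + μ ^ 2 / (2 * s ^ 2))
  have hfC : ∀ x, f x = C * exp (-(x - μ) ^ 2 / (2 * s ^ 2)) := fun x ↦ by
    rw [hq, ← exp_add, has]
    congr 1
    simp only [μ]
    field_simp
    ring
  have hgauss : ∫ x, exp (-(x - μ) ^ 2 / (2 * s ^ 2)) = s * √(2 * π) := by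
    have h1 := integral_sub_right_eq_self (μ := volume)
      (fun x : ℝ ↦ exp (-(1 / (2 * s ^ 2)) * x ^ 2)) μ
    rw [integral_gaussian] at h1
    have h2 : π / (1 / (2 * s ^ 2)) = s ^ 2 * (2 * π) := by field_simp
    rw [h2, Real.sqrt_mul (sq_nonneg s), Real.sqrt_sq hs.le] at h1
    rw [← h1]
    congr 1 with x
    congr 1
    ring
  refine ⟨μ, s, hs, fun x ↦ ?_⟩
  have hC : C * (s * √(2 * π)) = 1 := by
    rw [← hgauss, ← integral_const_mul, ← hf]
    simp only [hfC]
  rw [hfC, eq_one_div_of_mul_eq_one_left hC]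

theorem anosov_theorem
    (n : ℕ) (hn : 3 ≤ n)
    (f : ℝ → ℝ)
    (hf_pos : ∀ x, 0 < f x)
    (hf_cont : Continuous f)
    (hf_int : ∫ x, f x = 1)
    (T : (Fin (n - 2) → ℝ) → ℝ)
    (hT_nonneg : ∀ φ ∈ PhiSet n, 0 ≤ T φ)
    (hT_cont : ContinuousOn T (PhiSet n))
    (hT_integrable : IntegrableOn T (PhiSet n) volume)
    (hT_pos : 0 < ∫ φ in PhiSet n, T φ)
    (σ : Fin n → (Fin (n - 2) → ℝ) → ℝ)
    (hσ_cont : ∀ j, ContinuousOn (σ j) (PhiSet n))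
    (hσ_sum : ∀ φ ∈ PhiSet n, ∑ j, σ j φ = 0)
    (hσ_sq : ∀ φ ∈ PhiSet n, 0 < ∑ j, (σ j φ) ^ 2)
    (c : ℝ) (hc : 0 < c)
    (heq : ∀ x : ℝ, ∀ s : ℝ, 0 ≤ s →
      ∫ φ in PhiSet n, (∏ j, f (x + s * σ j φ)) * T φ
        = c * (f x) ^ n * ∫ φ in PhiSet n, (∏ j, f (s * σ j φ)) * T φ) :
    ∃ μ σ₀ : ℝ, 0 < σ₀ ∧
      ∀ x, f x = (1 / (σ₀ * Real.sqrt (2 * π))) *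
        Real.exp (-(x - μ) ^ 2 / (2 * σ₀ ^ 2)) := by
  refine (exists_quadratic_of_parabolaTouchesAbove (h := fun x ↦ log (f x))
    (hf_cont.log fun x ↦ (hf_pos x).ne') fun a b ha hb ↦ ?_).elim fun a ⟨b, c, hq⟩ ↦
      exists_eq_normal_density_of_eq_exp_quadratic hf_int fun x ↦ by
        rw [← hq, exp_log (hf_pos x)]
  refine le_of_parabolaTouchesAbove_of_setIntegral_eq (isCompact_phiSet n) hT_cont hT_nonneg hT_pos
    hσ_cont hσ_sum hσ_sq (hf_cont.log fun x ↦ (hf_pos x).ne') (fun s hs ↦ ?_) ha hb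
  refine ⟨c * ∫ φ in PhiSet n, (∏ j, f (s * σ j φ)) * T φ, fun x ↦ ?_⟩
  have hexp : ∀ φ, exp (∑ j, (log (f (x + s * σ j φ)) - log (f x))) * T φ =
      ((f x) ^ n)⁻¹ * ((∏ j, f (x + s * σ j φ)) * T φ) := fun φ ↦ by
    simp only [exp_sum, exp_sub, exp_log (hf_pos _), Finset.prod_div_distrib, Finset.prod_const,
      Finset.card_univ, Fintype.card_fin]
    ring
  simp only [hexp]
  rw [integral_const_mul, heq x s hs]
  have := (pow_pos (hf_pos x) n).ne'
  field_simp
end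

section
/- (Theorem A) Let n ≥ 3 and let f be a positive continuous probability density on ℝ. Let B_{n−2} = {(t_1,…,t_{n−2}) ∈ ℝ^{n−2} : −1 ≤ t_1 ≤ −1/(n−1), and for k = 2,…,n−2, max{((n−k+2)/(n−k))^{1/2} t_{k−1}, −g_{k−1}^{1/2}} ≤ t_k ≤ −g_{k−1}^{1/2}/(n−k)}, where g_k(t_1,…,t_k) = 1 − t_1² − ⋯ − t_k². Let T be a nonnegative continuous function on B_{n−2} with 0 < ∫_{B_{n−2}} T(t) dt < ∞, and let σ_1,…,σ_n be continuous functions on B_{n−2} with ∑_{j=1}^n σ_j(t) = 0 and 0 < ∑_{j=1}^n σ_j(t)² < ∞ for all t ∈ B_{n−2}. If there is a constant c > 0 such that ∫_{B_{n−2}} ∏_{j=1}^n f(x + s σ_j(t)) T(t) dt = c (f(x))^n ∫_{B_{n−2}} ∏_{j=1}^n f(s σ_j(t)) T(t) dt for all x ∈ ℝ and all s ≥ 0, then f is a normal density, i.e. f(x) = (1/(σ√(2π))) exp(−(x−μ)²/(2σ²)) for some μ ∈ ℝ and σ > 0. -/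
open MeasureTheory ProbabilityTheory Real

/-- `gfun t k = 1 - t₁² - ⋯ - t_k²` (the first `k` coordinates of `t`). -/
noncomputable def gfun {m : ℕ} (t : Fin m → ℝ) (k : ℕ) : ℝ :=
  1 - ∑ j : Fin m, if (j : ℕ) < k then (t j) ^ 2 else 0

/-- The set `B_{n-2} ⊂ ℝ^{n-2}`. Coordinate `i : Fin (n-2)` corresponds to `t_{i+1}`
in the paper's (1-based) notation. -/
noncomputable def Bset (n : ℕ) : Set (Fin (n - 2) → ℝ) :=
  {t | ∀ i : Fin (n - 2),
    ((i : ℕ) = 0 → -1 ≤ t i ∧ t i ≤ -1 / ((n : ℝ) - 1)) ∧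
    (1 ≤ (i : ℕ) →
      max (Real.sqrt (((n : ℝ) - ((i : ℕ) + 1) + 2) / ((n : ℝ) - ((i : ℕ) + 1))) *
            t ⟨(i : ℕ) - 1, lt_of_le_of_lt (Nat.sub_le _ _) i.isLt⟩)
          (-(Real.sqrt (gfun t (i : ℕ)))) ≤ t i ∧
      t i ≤ -(Real.sqrt (gfun t (i : ℕ))) / ((n : ℝ) - ((i : ℕ) + 1)))}

open Set Filter Topology

/-- Every point of `Bset n` has all its coordinates in `[-1, 0]`. -/
lemma Bset_subset_Icc (n : ℕ) : Bset n ⊆ Icc (fun _ => -1) (fun _ => 0) := by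
  have key : ∀ t ∈ Bset n, ∀ i : Fin (n - 2), -1 ≤ t i ∧ t i ≤ 0 := by
    intro t ht i
    have hi : (i : ℝ) + 1 ≤ n := by
      have := i.isLt
      exact_mod_cast (by omega : (i : ℕ) + 1 ≤ n)
    rcases Nat.eq_zero_or_pos (i : ℕ) with h0 | h0
    · obtain ⟨h1, h2⟩ := (ht i).1 h0
      rw [h0] at hi
      refine ⟨h1, h2.trans (div_nonpos_of_nonpos_of_nonneg (by norm_num) ?_)⟩
      push_cast at hi
      linarith
    · obtain ⟨h1, h2⟩ := (ht i).2 h0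
      have hg : gfun t (i : ℕ) ≤ 1 := by
        have : 0 ≤ ∑ j : Fin (n - 2), if (j : ℕ) < (i : ℕ) then (t j) ^ 2 else 0 :=
          Finset.sum_nonneg fun j _ => by split_ifs <;> positivity
        unfold gfun
        linarith
      have hs : Real.sqrt (gfun t (i : ℕ)) ≤ 1 := Real.sqrt_le_one.mpr hg
      refine ⟨by linarith [(le_max_right _ _).trans h1], h2.trans ?_⟩
      exact div_nonpos_of_nonpos_of_nonneg (neg_nonpos.mpr (Real.sqrt_nonneg _)) (by linarith)
  exact fun t ht => ⟨fun i => (key t ht i).1, fun i => (key t ht i).2⟩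

lemma continuous_gfun {m : ℕ} (k : ℕ) : Continuous fun t : Fin m → ℝ => gfun t k := by
  unfold gfun
  refine continuous_const.sub (continuous_finsetSum _ fun j _ => ?_)
  split_ifs <;> fun_prop

lemma isClosed_Bset (n : ℕ) : IsClosed (Bset n) := by
  have hg : ∀ k, Continuous fun t : Fin (n - 2) → ℝ => Real.sqrt (gfun t k) :=
    fun k => Real.continuous_sqrt.comp (continuous_gfun k)
  unfold Bset
  simp only [ofPred_forall, ofPred_and]
  refine isClosed_iInter fun i => IsClosed.inter (isClosed_iInter fun _ => IsClosed.inter ?_ ?_)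
    (isClosed_iInter fun _ => IsClosed.inter ?_ ?_)
  · exact isClosed_le (by fun_prop) (by fun_prop)
  · exact isClosed_le (by fun_prop) (by fun_prop)
  · exact isClosed_le ((continuous_const.mul (continuous_apply _)).max (hg _).neg)
      (continuous_apply _)
  · exact isClosed_le (continuous_apply _) ((hg _).neg.div_const _)

lemma isCompact_Bset (n : ℕ) : IsCompact (Bset n) :=
  isCompact_Icc.of_isClosed_subset (isClosed_Bset n) (Bset_subset_Icc n)

/-- A continuous function on an interval that exceeds its endpoint values somewhere inside
has an interior local maximum. -/
lemma exists_isLocalMax_of_endpoints_lt {h : ℝ → ℝ} (hh : Continuous h) {p x q : ℝ}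
    (hpx : p < x) (hxq : x < q) (hp : h p < h x) (hq : h q < h x) :
    ∃ z, IsLocalMax h z := by
  obtain ⟨z, hz, hmax⟩ := isCompact_Icc.exists_isMaxOn
    ⟨x, hpx.le, hxq.le⟩ (hh.continuousOn (s := Icc p q))
  have hxz : h x ≤ h z := hmax ⟨hpx.le, hxq.le⟩
  have hpz : z ≠ p := by rintro rfl; linarith
  have hqz : z ≠ q := by rintro rfl; linarith
  exact ⟨z, hmax.isLocalMax
    (Icc_mem_nhds (lt_of_le_of_ne hz.1 hpz.symm) (lt_of_le_of_ne hz.2 hqz))⟩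

/-- The leading coefficients of the quadratics touching `φ` locally from above. -/
def upperCurvatures (φ : ℝ → ℝ) : Set ℝ :=
  {a | ∃ b x₀, IsLocalMax (fun x => φ x - (a * x ^ 2 + b * x)) x₀}

lemma upperCurvatures_nonempty {φ : ℝ → ℝ} (hφ : Continuous φ) :
    (upperCurvatures φ).Nonempty := by
  refine ⟨|φ 1 - φ 0| + |φ (-1) - φ 0| + 1, 0,
    exists_isLocalMax_of_endpoints_lt (p := -1) (x := 0) (q := 1)
      (by fun_prop) (by norm_num) (by norm_num) ?_ ?_⟩
  · have := abs_nonneg (φ 1 - φ 0)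
    have := le_abs_self (φ (-1) - φ 0)
    norm_num
    linarith
  · have := abs_nonneg (φ (-1) - φ 0)
    have := le_abs_self (φ 1 - φ 0)
    norm_num
    linarith

lemma le_chord_of_upperCurvatures_nonneg {ψ : ℝ → ℝ} (hψ : Continuous ψ)
    (hup : ∀ a ∈ upperCurvatures ψ, 0 ≤ a) {p x q : ℝ} (hpx : p < x) (hxq : x < q) :
    (q - p) * ψ x ≤ (q - x) * ψ p + (x - p) * ψ q := by
  by_contra! hlt
  have hpq : 0 < q - p := by linarith
  have hxp : 0 < x - p := by linarith
  have hqx : 0 < q - x := by linarith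
  obtain ⟨b, hb⟩ : ∃ b, b * (q - p) = ψ q - ψ p :=
    ⟨(ψ q - ψ p) / (q - p), div_mul_cancel₀ _ hpq.ne'⟩
  have hδ : 0 < ψ x - ψ p - b * (x - p) := by
    have : 0 < (q - p) * (ψ x - ψ p - b * (x - p)) := by
      linear_combination hlt + (x - p) * hb
    exact pos_of_mul_pos_right this hpq.le
  obtain ⟨ε, hε, hεδ⟩ : ∃ ε, 0 < ε ∧ ε * ((x - p) * (q - x)) < ψ x - ψ p - b * (x - p) := by
    have hm : 0 < (x - p) * (q - x) := by positivity
    refine ⟨(ψ x - ψ p - b * (x - p)) / 2 / ((x - p) * (q - x)), by positivity, ?_⟩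
    rw [div_mul_cancel₀ _ hm.ne']
    linarith
  have := hup (-ε) ⟨b + ε * (p + q), exists_isLocalMax_of_endpoints_lt
    (by fun_prop) hpx hxq (by linear_combination hεδ) (by linear_combination hεδ - hb)⟩
  linarith

lemma upperCurvatures_sub_sq {φ : ℝ → ℝ} {m a : ℝ}
    (ha : a ∈ upperCurvatures fun x => φ x - m * x ^ 2) : a + m ∈ upperCurvatures φ := by
  obtain ⟨b, x₀, h⟩ := ha
  refine ⟨b, x₀, ?_⟩
  convert h using 2
  ring

/-- A continuous function all of whose touching quadratics from above are at least as curved as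
those from below is a quadratic polynomial. -/
lemma exists_quadratic_of_curvatures {φ : ℝ → ℝ} (hφ : Continuous φ)
    (h : ∀ a ∈ upperCurvatures φ, ∀ b ∈ upperCurvatures (-φ), -b ≤ a) :
    ∃ m β γ, ∀ x, φ x = m * x ^ 2 + β * x + γ := by
  obtain ⟨b₀, hb₀⟩ := upperCurvatures_nonempty hφ.neg
  obtain ⟨m, hm1, hm2⟩ := exists_between_of_forall_le
    (s := {y | ∃ b ∈ upperCurvatures (-φ), y = -b}) ⟨-b₀, b₀, hb₀, rfl⟩
    (upperCurvatures_nonempty hφ) (by rintro _ ⟨b, hb, rfl⟩ a ha; exact h a ha b hb)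
  have hup : ∀ a ∈ upperCurvatures fun x => φ x - m * x ^ 2, 0 ≤ a := fun a ha => by
    linarith [hm2 (upperCurvatures_sub_sq ha)]
  have hlow : ∀ a ∈ upperCurvatures fun x => (-φ) x - (-m) * x ^ 2, 0 ≤ a := fun a ha => by
    linarith [hm1 ⟨_, upperCurvatures_sub_sq ha, rfl⟩]
  have hchord : ∀ p x q : ℝ, p < x → x < q →
      (q - p) * (φ x - m * x ^ 2) =
        (q - x) * (φ p - m * p ^ 2) + (x - p) * (φ q - m * q ^ 2) := fun p x q hp hq => by
    have h1 := le_chord_of_upperCurvatures_nonneg (by fun_prop) hup hp hq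
    have h2 := le_chord_of_upperCurvatures_nonneg
      ((hφ.neg).sub (by fun_prop)) hlow hp hq
    simp only [Pi.neg_apply, Pi.sub_apply] at h2
    linarith
  refine ⟨m, φ 1 - m - φ 0, φ 0, fun x => ?_⟩
  rcases lt_trichotomy x 0 with hx | rfl | hx
  · linear_combination -hchord x 0 1 hx one_pos
  · ring
  rcases lt_trichotomy x 1 with hx1 | rfl | hx1
  · linear_combination hchord 0 x 1 hx hx1
  · ring
  · linear_combination -hchord 0 1 x one_pos hx1

/-- If `φ` is touched from above at `x₀` by a quadratic with leading coefficient `a`, sums of `φ`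
over centred small perturbations of `x₀` are controlled by `a`. -/
lemma eventually_sum_le_of_isLocalMax {ι X : Type*} [Fintype ι] {φ : ℝ → ℝ} {a b x₀ : ℝ}
    (hmax : IsLocalMax (fun x => φ x - (a * x ^ 2 + b * x)) x₀) {K : Set X} {σ : ι → X → ℝ}
    {R : ℝ} (hR : ∀ t ∈ K, ∀ j, |σ j t| ≤ R) (hsum : ∀ t ∈ K, ∑ j, σ j t = 0) :
    ∀ᶠ s in 𝓝 (0 : ℝ), ∀ t ∈ K, ∑ j, φ (x₀ + s * σ j t) ≤
      Fintype.card ι * φ x₀ + a * s ^ 2 * ∑ j, (σ j t) ^ 2 := by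
  obtain ⟨ε, hε, hball⟩ := Metric.eventually_nhds_iff.mp hmax
  have hlim : Tendsto (fun s : ℝ => |s| * |R|) (𝓝 0) (𝓝 0) :=
    Continuous.tendsto' (by fun_prop) _ _ (by simp)
  filter_upwards [hlim.eventually_lt_const hε] with s hs t ht
  have hj : ∀ j, φ (x₀ + s * σ j t) ≤
      φ x₀ + a * s ^ 2 * (σ j t) ^ 2 + (2 * a * x₀ + b) * s * σ j t := fun j => by
    have hd : dist (x₀ + s * σ j t) x₀ < ε := by
      rw [Real.dist_eq, add_sub_cancel_left, abs_mul]
      exact lt_of_le_of_lt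
        (mul_le_mul_of_nonneg_left ((hR t ht j).trans (le_abs_self R)) (abs_nonneg s)) hs
    linear_combination hball hd
  refine (Finset.sum_le_sum fun j _ => hj j).trans_eq ?_
  rw [Finset.sum_add_distrib, Finset.sum_add_distrib, ← Finset.mul_sum, ← Finset.mul_sum,
    hsum t ht]
  simp

/-- Under the integral equation, quadratics touching `φ` from above are at least as curved as
those touching it from below. -/
lemma neg_le_of_mem_upperCurvatures {ι X : Type*} [Fintype ι] [TopologicalSpace X]
    [MeasurableSpace X] [OpensMeasurableSpace X] {ν : Measure X} {K : Set X} (hK : IsCompact K)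
    (hKm : MeasurableSet K) {φ : ℝ → ℝ} (hφ : Continuous φ) {T : X → ℝ}
    (hT_nonneg : ∀ t ∈ K, 0 ≤ T t) (hT_int : IntegrableOn T K ν) (hT_pos : 0 < ∫ t in K, T t ∂ν)
    {σ : ι → X → ℝ} (hσ : ∀ j, ContinuousOn (σ j) K) (hsum : ∀ t ∈ K, ∑ j, σ j t = 0)
    (hsq : ∀ t ∈ K, 0 < ∑ j, (σ j t) ^ 2) {I : ℝ → ℝ}
    (heq : ∀ x s : ℝ, 0 ≤ s → ∫ t in K, Real.exp (∑ j, φ (x + s * σ j t)) * T t ∂ν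
      = Real.exp (Fintype.card ι * φ x) * I s)
    {a b : ℝ} (ha : a ∈ upperCurvatures φ) (hb : b ∈ upperCurvatures (-φ)) : -b ≤ a := by
  by_contra! hlt
  obtain ⟨a', x, hx⟩ := ha
  obtain ⟨b', y, hy⟩ := hb
  obtain ⟨R, hR⟩ : ∃ R, ∀ t ∈ K, ∀ j, |σ j t| ≤ R := by
    obtain ⟨R, hR⟩ := hK.exists_bound_of_continuousOn (continuousOn_pi.mpr hσ)
    exact ⟨R, fun t ht j => (norm_le_pi_norm (fun j => σ j t) j).trans (hR t ht)⟩
  have hev := (eventually_sum_le_of_isLocalMax hx hR hsum).and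
    (eventually_sum_le_of_isLocalMax hy hR hsum)
  obtain ⟨s, ⟨hs1, hs2⟩, hs⟩ :=
    ((hev.filter_mono nhdsWithin_le_nhds).and (self_mem_nhdsWithin (s := Ioi (0 : ℝ)))).exists
  replace hs : 0 < s := hs
  have hS : ContinuousOn (fun t => ∑ j, (σ j t) ^ 2) K :=
    continuousOn_finsetSum _ fun j _ => (hσ j).pow 2
  have hint : ∀ {u : X → ℝ}, ContinuousOn u K →
      IntegrableOn (fun t => Real.exp (u t) * T t) K ν := fun hu =>
    IntegrableOn.continuousOn_mul_of_subset (Real.continuous_exp.comp_continuousOn hu) hT_int hK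
      hKm subset_rfl
  have hquad : ∀ k : ℝ, ContinuousOn (fun t => k * s ^ 2 * ∑ j, (σ j t) ^ 2) K :=
    fun k => continuousOn_const.mul hS
  have haff : ∀ z k : ℝ, ContinuousOn
      (fun t => Fintype.card ι * φ z + k * s ^ 2 * ∑ j, (σ j t) ^ 2) K :=
    fun z k => continuousOn_const.add (hquad k)
  have hφσ : ∀ z : ℝ, ContinuousOn (fun t => ∑ j, φ (z + s * σ j t)) K := fun z =>
    continuousOn_finsetSum _ fun j _ =>
      hφ.comp_continuousOn (continuousOn_const.add (continuousOn_const.mul (hσ j)))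
  have hpull : ∀ z k : ℝ, ∫ t in K, Real.exp (Fintype.card ι * φ z +
        k * s ^ 2 * ∑ j, (σ j t) ^ 2) * T t ∂ν =
      Real.exp (Fintype.card ι * φ z) *
        ∫ t in K, Real.exp (k * s ^ 2 * ∑ j, (σ j t) ^ 2) * T t ∂ν :=
    fun z k => by
      rw [← integral_const_mul]
      simp only [Real.exp_add, mul_assoc]
  have h1 : I s ≤ ∫ t in K, Real.exp (a * s ^ 2 * ∑ j, (σ j t) ^ 2) * T t ∂ν := by
    have := setIntegral_mono_on (hint (hφσ x))
      (hint (haff x a)) hKm fun t ht =>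
      mul_le_mul_of_nonneg_right (Real.exp_le_exp.mpr (hs1 t ht)) (hT_nonneg t ht)
    rw [heq x s hs.le, hpull] at this
    exact le_of_mul_le_mul_left this (Real.exp_pos _)
  have h2 : ∫ t in K, Real.exp (-b * s ^ 2 * ∑ j, (σ j t) ^ 2) * T t ∂ν ≤ I s := by
    have := setIntegral_mono_on (hint (haff y (-b))) (hint (hφσ y))
      hKm fun t ht => mul_le_mul_of_nonneg_right (Real.exp_le_exp.mpr
        (show Fintype.card ι * φ y + -b * s ^ 2 * ∑ j, (σ j t) ^ 2 ≤ _ by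
          have := hs2 t ht
          simp only [Pi.neg_apply, Finset.sum_neg_distrib] at this
          linarith)) (hT_nonneg t ht)
    rw [heq y s hs.le, hpull] at this
    exact le_of_mul_le_mul_left this (Real.exp_pos _)
  have hexp : ∀ t ∈ K, Real.exp (a * s ^ 2 * ∑ j, (σ j t) ^ 2) <
      Real.exp (-b * s ^ 2 * ∑ j, (σ j t) ^ 2) := fun t ht => by
    have := hsq t ht
    gcongr
  have hnn : 0 ≤ᵐ[ν.restrict K] fun t => Real.exp (-b * s ^ 2 * ∑ j, (σ j t) ^ 2) * T t -
      Real.exp (a * s ^ 2 * ∑ j, (σ j t) ^ 2) * T t :=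
    (ae_restrict_mem hKm).mono fun t ht =>
      sub_nonneg.mpr (mul_le_mul_of_nonneg_right (hexp t ht).le (hT_nonneg t ht))
  have hdiff := integral_sub (hint (hquad (-b))) (hint (hquad a))
  have hzero := (integral_eq_zero_iff_of_nonneg_ae hnn
    ((hint (hquad (-b))).sub (hint (hquad a)))).mp
      (le_antisymm (by linarith) (integral_nonneg_of_ae hnn))
  have hTzero : T =ᵐ[ν.restrict K] 0 := by
    filter_upwards [hzero, ae_restrict_mem hKm] with t ht htK
    rw [← sub_mul] at ht
    exact (mul_eq_zero.mp ht).resolve_left (sub_pos.mpr (hexp t htK)).ne'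
  rw [integral_congr_ae hTzero] at hT_pos
  simp at hT_pos

/-- A probability density that is the exponential of a quadratic polynomial is normal. -/
lemma exists_normal_of_exp_quadratic {f : ℝ → ℝ} (hf_int : ∫ x, f x = 1) {m β γ : ℝ}
    (hf : ∀ x, f x = Real.exp (m * x ^ 2 + β * x + γ)) :
    ∃ μ σ₀ : ℝ, 0 < σ₀ ∧
      ∀ x, f x = (1 / (σ₀ * Real.sqrt (2 * π))) *
        Real.exp (-(x - μ) ^ 2 / (2 * σ₀ ^ 2)) := by
  have hint : Integrable f := by
    by_contra h
    simp [integral_undef h] at hf_int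
  have hm : m < 0 := by
    by_contra! hm
    have hconst : Integrable fun _ : ℝ => 2 * Real.exp γ := by
      refine (hint.add hint.comp_neg).mono' (by fun_prop) (Eventually.of_forall fun x => ?_)
      rw [Real.norm_of_nonneg (by positivity)]
      simp only [Pi.add_apply, hf]
      have e : ∀ y, Real.exp γ * (y + 1) ≤ Real.exp (y + γ) := fun y => by
        rw [Real.exp_add, mul_comm]
        gcongr
        exact Real.add_one_le_exp y
      have := e (m * x ^ 2 + β * x)
      have := e (m * (-x) ^ 2 + β * (-x))
      nlinarith [mul_nonneg (Real.exp_pos γ).le (mul_nonneg hm (sq_nonneg x))]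
    rw [integrable_const_iff] at hconst
    rcases hconst with h | h
    · exact (by positivity : 2 * Real.exp γ ≠ 0) h
    · simpa using h.measure_univ_lt_top
  set σ₀ : ℝ := Real.sqrt (-1 / (2 * m)) with hσ₀
  have hv : 0 < -1 / (2 * m) := div_pos_of_neg_of_neg (by norm_num) (by linarith)
  have hσpos : 0 < σ₀ := Real.sqrt_pos.mpr hv
  have hσsq : σ₀ ^ 2 = -1 / (2 * m) := Real.sq_sqrt hv.le
  set μ : ℝ := -β / (2 * m) with hμ
  have hfC : ∀ x, f x = Real.exp (γ - m * μ ^ 2) * Real.exp (-(x - μ) ^ 2 / (2 * σ₀ ^ 2)) := by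
    intro x
    rw [hf, ← Real.exp_add, hσsq, hμ]
    congr 1
    have := hm.ne
    field_simp
    ring
  have hpdf : ∀ x, gaussianPDFReal μ (Real.toNNReal (σ₀ ^ 2)) x =
      (1 / (σ₀ * Real.sqrt (2 * π))) * Real.exp (-(x - μ) ^ 2 / (2 * σ₀ ^ 2)) := by
    intro x
    rw [gaussianPDFReal, Real.coe_toNNReal _ (sq_nonneg σ₀), mul_comm (2 * π),
      Real.sqrt_mul (sq_nonneg σ₀), Real.sqrt_sq hσpos.le, one_div]
  have hone := integral_gaussianPDFReal_eq_one μ (v := Real.toNNReal (σ₀ ^ 2))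
    (by simpa using hσpos.ne')
  simp only [hpdf, integral_const_mul] at hone
  simp only [hfC, integral_const_mul] at hf_int
  refine ⟨μ, σ₀, hσpos, fun x => ?_⟩
  rw [hfC, mul_right_cancel₀ (right_ne_zero_of_mul_eq_one hone) (hf_int.trans hone.symm)]

theorem anosov_theorem_on_Bset
    (n : ℕ) (hn : 3 ≤ n)
    (f : ℝ → ℝ)
    (hf_pos : ∀ x, 0 < f x)
    (hf_cont : Continuous f)
    (hf_int : ∫ x, f x = 1)
    (T : (Fin (n - 2) → ℝ) → ℝ)
    (hT_nonneg : ∀ t ∈ Bset n, 0 ≤ T t)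
    (hT_cont : ContinuousOn T (Bset n))
    (hT_integrable : IntegrableOn T (Bset n) volume)
    (hT_pos : 0 < ∫ t in Bset n, T t)
    (σ : Fin n → (Fin (n - 2) → ℝ) → ℝ)
    (hσ_cont : ∀ j, ContinuousOn (σ j) (Bset n))
    (hσ_sum : ∀ t ∈ Bset n, ∑ j, σ j t = 0)
    (hσ_sq : ∀ t ∈ Bset n, 0 < ∑ j, (σ j t) ^ 2)
    (c : ℝ) (hc : 0 < c)
    (heq : ∀ x : ℝ, ∀ s : ℝ, 0 ≤ s →
      ∫ t in Bset n, (∏ j, f (x + s * σ j t)) * T t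
        = c * (f x) ^ n * ∫ t in Bset n, (∏ j, f (s * σ j t)) * T t) :
    ∃ μ σ₀ : ℝ, 0 < σ₀ ∧
      ∀ x, f x = (1 / (σ₀ * Real.sqrt (2 * π))) *
        Real.exp (-(x - μ) ^ 2 / (2 * σ₀ ^ 2)) := by
  have hexp : ∀ x, Real.exp (Real.log (f x)) = f x := fun x => Real.exp_log (hf_pos x)
  have hlog : Continuous fun x => Real.log (f x) := hf_cont.log fun x => (hf_pos x).ne'
  obtain ⟨m, β, γ, hquad⟩ := exists_quadratic_of_curvatures hlog fun a ha b hb =>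
    neg_le_of_mem_upperCurvatures (isCompact_Bset n) (isClosed_Bset n).measurableSet hlog
      hT_nonneg hT_integrable hT_pos hσ_cont hσ_sum hσ_sq
      (I := fun s => c * ∫ t in Bset n, (∏ j, f (s * σ j t)) * T t)
      (fun x s hs => by
        simp only [Real.exp_sum, hexp, Fintype.card_fin, Real.exp_nat_mul, heq x s hs]
        ring) ha hb
  exact exists_normal_of_exp_quadratic hf_int fun x => by rw [← hquad, hexp]
end

section
/- (Lemma 2) Let n ≥ 3 and let B_{n−2} = {(t_1,…,t_{n−2}) ∈ ℝ^{n−2} : −1 ≤ t_1 ≤ −1/(n−1), and for k = 2,…,n−2, max{((n−k+2)/(n−k))^{1/2} t_{k−1}, −g_{k−1}^{1/2}} ≤ t_k ≤ −g_{k−1}^{1/2}/(n−k)}, where g_k(t_1,…,t_k) = 1 − t_1² − ⋯ − t_k². Then g_{n−2} ≥ 0 on B_{n−2} and ∫_{B_{n−2}} (g_{n−2}(t))^{−1/2} dt_1 ⋯ dt_{n−2} = 2 π^{(n−1)/2} / (n! Γ((n−1)/2)). -/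
open MeasureTheory Real

open scoped ENNReal

/-- The Gaussian weight `exp (-|x|²)` with values in `ℝ≥0∞`. -/
noncomputable def gaussWeight {k : ℕ} (x : Fin k → ℝ) : ℝ≥0∞ :=
  ENNReal.ofReal (exp (-∑ i, x i ^ 2))

lemma measurable_gaussWeight {k : ℕ} : Measurable (gaussWeight (k := k)) := by
  unfold gaussWeight
  fun_prop

lemma measurable_snoc {k : ℕ} :
    Measurable fun p : ℝ × (Fin k → ℝ) => (Fin.snoc p.2 p.1 : Fin (k + 1) → ℝ) := by
  refine measurable_pi_lambda _ fun i => ?_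
  refine Fin.lastCases ?_ (fun j => ?_) i
  · simpa using measurable_fst
  · simp only [Fin.snoc_castSucc]
    fun_prop

lemma gaussWeight_snoc {k : ℕ} (s : Fin k → ℝ) (a : ℝ) :
    gaussWeight (Fin.snoc s a : Fin (k + 1) → ℝ) =
      ENNReal.ofReal (exp (-a ^ 2)) * gaussWeight s := by
  unfold gaussWeight
  rw [← ENNReal.ofReal_mul (exp_pos _).le, ← exp_add, Fin.sum_univ_castSucc]
  simp only [Fin.snoc_castSucc, Fin.snoc_last]
  ring_nf

lemma lintegral_eq_lintegral_snoc {k : ℕ} {F : (Fin (k + 1) → ℝ) → ℝ≥0∞} (hF : Measurable F) :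
    ∫⁻ y, F y = ∫⁻ a : ℝ, ∫⁻ s : Fin k → ℝ, F (Fin.snoc s a) := by
  have h := (volume_preserving_piFinSuccAbove (fun _ : Fin (k + 1) => ℝ) (Fin.last k)).symm
  rw [← h.lintegral_comp hF, Measure.volume_eq_prod, lintegral_prod]
  · refine lintegral_congr fun a => lintegral_congr fun s => congrArg F ?_
    exact Fin.insertNth_last' a s
  · exact (hF.comp (MeasurableEquiv.measurable _)).aemeasurable

lemma lintegral_exp_neg_sq : ∫⁻ a : ℝ, ENNReal.ofReal (exp (-a ^ 2)) = ENNReal.ofReal √π := by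
  rw [← ofReal_integral_eq_lintegral_ofReal]
  · congr 1
    simpa using integral_gaussian 1
  · simpa using integrable_exp_neg_mul_sq (b := 1) one_pos
  · exact Filter.Eventually.of_forall fun _ => (exp_pos _).le

lemma lintegral_gaussWeight (k : ℕ) :
    ∫⁻ x : Fin k → ℝ, gaussWeight x = ENNReal.ofReal √π ^ k := by
  induction k with
  | zero => simp [gaussWeight, volume_pi]
  | succ k ih =>
    rw [lintegral_eq_lintegral_snoc measurable_gaussWeight]
    simp only [gaussWeight_snoc]
    simp_rw [lintegral_const_mul _ measurable_gaussWeight, ih]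
    rw [lintegral_mul_const _ (by fun_prop), lintegral_exp_neg_sq, pow_succ']

lemma ae_injective (k : ℕ) : ∀ᵐ x : Fin k → ℝ, Function.Injective x := by
  have h : ∀ i j : Fin k, i ≠ j → ∀ᵐ x : Fin k → ℝ, x i ≠ x j := by
    intro i j hij
    let S : Submodule ℝ (Fin k → ℝ) :=
      LinearMap.ker (LinearMap.proj (R := ℝ) (φ := fun _ : Fin k => ℝ) i - LinearMap.proj j)
    have hS : S ≠ ⊤ := by
      intro h
      have h1 : (Pi.single i 1 : Fin k → ℝ) ∈ S := h ▸ Submodule.mem_top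
      simp [S, hij.symm] at h1
    have h0 := Measure.addHaar_submodule (volume : Measure (Fin k → ℝ)) S hS
    rw [ae_iff]
    convert h0 using 2
    ext x
    simp [S, sub_eq_zero]
  have h' : ∀ᵐ x : Fin k → ℝ, ∀ i j : Fin k, i ≠ j → x i ≠ x j := by
    rw [ae_all_iff]; intro i
    rw [ae_all_iff]; intro j
    by_cases hij : i = j
    · simp [hij]
    · simpa [hij] using h i j hij
  filter_upwards [h'] with x hx i j hij
  by_contra hne
  exact hx i j hne hij

lemma measurableSet_monotone (k : ℕ) : MeasurableSet {x : Fin k → ℝ | Monotone x} := by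
  have : {x : Fin k → ℝ | Monotone x} = ⋂ i, ⋂ j, ⋂ _ : i ≤ j, {x | x i ≤ x j} := by
    ext x
    simp [Monotone]
  rw [this]
  refine MeasurableSet.iInter fun i => MeasurableSet.iInter fun j => MeasurableSet.iInter fun _ => ?_
  exact measurableSet_le (measurable_pi_apply i) (measurable_pi_apply j)

/-- The increasing vectors carry the fraction `1 / k!` of the Gaussian mass. -/
lemma factorial_mul_lintegral_monotone (k : ℕ) :
    (k.factorial : ℝ≥0∞) * ∫⁻ x in {x : Fin k → ℝ | Monotone x}, gaussWeight x =
      ENNReal.ofReal √π ^ k := by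
  classical
  set K : Set (Fin k → ℝ) := {x | Monotone x} with hK
  have hmeas : MeasurableSet K := measurableSet_monotone k
  have hind : Measurable (K.indicator gaussWeight) := measurable_gaussWeight.indicator hmeas
  have hperm : ∀ σ : Equiv.Perm (Fin k), MeasurePreserving
      (fun x : Fin k → ℝ => x ∘ σ) volume volume := by
    intro σ
    convert volume_measurePreserving_piCongrLeft (fun _ : Fin k => ℝ) σ.symm using 1
    ext x i
    have := MeasurableEquiv.piCongrLeft_apply_apply (β := fun _ : Fin k => ℝ) σ.symm x (σ i)
    simpa using this.symm
  have hσ : ∀ σ : Equiv.Perm (Fin k),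
      ∫⁻ x : Fin k → ℝ, K.indicator gaussWeight (x ∘ σ) = ∫⁻ x in K, gaussWeight x := by
    intro σ
    rw [← lintegral_indicator hmeas]
    exact (hperm σ).lintegral_comp hind
  have hsum : ∑ σ : Equiv.Perm (Fin k), ∫⁻ x : Fin k → ℝ, K.indicator gaussWeight (x ∘ σ) =
      ∫⁻ x : Fin k → ℝ, gaussWeight x := by
    have hm : ∀ σ : Equiv.Perm (Fin k),
        Measurable fun x : Fin k → ℝ => K.indicator gaussWeight (x ∘ σ) :=
      fun σ => hind.comp (hperm σ).measurable
    rw [← lintegral_finsetSum _ fun σ _ => hm σ]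
    refine lintegral_congr_ae ?_
    filter_upwards [ae_injective k] with x hx
    rw [Finset.sum_eq_single (Tuple.sort x)]
    · have hm : x ∘ Tuple.sort x ∈ K := Tuple.monotone_sort x
      rw [Set.indicator_of_mem hm]
      unfold gaussWeight
      simp only [Function.comp_apply]
      rw [Equiv.sum_comp (Tuple.sort x) fun i => x i ^ 2]
    · intro σ _ hne
      refine Set.indicator_of_notMem (fun hm => hne ?_) _
      exact Tuple.eq_sort_iff.2 ⟨hm, fun i j hij h => absurd (σ.injective (hx h)) hij.ne⟩
    · simp
  rw [← lintegral_gaussWeight, ← hsum]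
  simp_rw [hσ]
  simp [Fintype.card_perm]

/-- The Helmert contrast of `X j` against the mean of `X 0, …, X (j - 1)`. -/
noncomputable def helmert (X : ℕ → ℝ) (j : ℕ) : ℝ :=
  √(j / (j + 1)) * ((∑ l ∈ Finset.range j, X l) / j - X j)

lemma sum_sq_helmert (X : ℕ → ℝ) (k : ℕ) :
    ∑ j ∈ Finset.range (k + 1), helmert X j ^ 2 +
      (∑ j ∈ Finset.range (k + 1), X j) ^ 2 / (k + 1) = ∑ j ∈ Finset.range (k + 1), X j ^ 2 := by
  induction k with
  | zero => simp [helmert]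
  | succ k ih =>
    rw [Finset.sum_range_succ, Finset.sum_range_succ _ (k + 1), Finset.sum_range_succ _ (k + 1),
      ← ih, helmert, mul_pow, sq_sqrt (by positivity)]
    push_cast
    field_simp
    ring

lemma helmert_one_nonpos (X : ℕ → ℝ) : helmert X 1 ≤ 0 ↔ X 0 ≤ X 1 := by
  have : 0 < √((1 : ℕ) / ((1 : ℕ) + 1) : ℝ) := by positivity
  rw [helmert, ← neg_nonneg, ← mul_neg, mul_nonneg_iff_of_pos_left this]
  simp

lemma helmert_succ_le (X : ℕ → ℝ) {j : ℕ} (hj : 0 < j) :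
    √((j + 2) / j) * helmert X (j + 1) ≤ helmert X j ↔ X j ≤ X (j + 1) := by
  have hj' : (0 : ℝ) < j := by exact_mod_cast hj
  have h1 : √(((j : ℝ) + 2) / j) * √(((j + 1 : ℕ) : ℝ) / ((j + 1 : ℕ) + 1)) =
      √(((j : ℝ) + 1) / j) := by
    rw [← sqrt_mul (by positivity)]
    congr 1
    push_cast
    field_simp
    ring
  have h2 : √((j : ℝ) / (j + 1)) = √(((j : ℝ) + 1) / j) * (j / (j + 1)) := by
    have : (j : ℝ) / (j + 1) = ((j : ℝ) + 1) / j * (j / (j + 1)) ^ 2 := by field_simp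
    rw [this, sqrt_mul (by positivity), sqrt_sq (by positivity), ← this]
  have h3 : helmert X j - √((j + 2) / j) * helmert X (j + 1) =
      √(((j : ℝ) + 1) / j) * (X (j + 1) - X j) := by
    unfold helmert
    rw [← mul_assoc, h1, h2, Finset.sum_range_succ]
    push_cast
    field_simp
    ring
  have hpos : 0 < √(((j : ℝ) + 1) / j) := by positivity
  rw [← sub_nonneg, h3, mul_nonneg_iff_of_pos_left hpos, sub_nonneg]

/-- Extension of a tuple by zero. -/
noncomputable def extendZero {k : ℕ} (x : Fin k → ℝ) (l : ℕ) : ℝ :=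
  if h : l < k then x ⟨l, h⟩ else 0

lemma extendZero_val {k : ℕ} (x : Fin k → ℝ) (i : Fin k) : extendZero x i = x i := by
  simp [extendZero]

/-- The Helmert coordinates, in decreasing order, followed by the normalized total. -/
noncomputable def helmertMap (m : ℕ) (x : Fin (m + 2) → ℝ) : Fin (m + 2) → ℝ :=
  Fin.snoc (fun i : Fin (m + 1) => helmert (extendZero x) (m + 1 - i))
    ((∑ l ∈ Finset.range (m + 2), extendZero x l) / √(m + 2))

lemma sum_sq_helmertMap (m : ℕ) (x : Fin (m + 2) → ℝ) :
    ∑ i, helmertMap m x i ^ 2 = ∑ i, x i ^ 2 := by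
  have h := sum_sq_helmert (extendZero x) (m + 1)
  rw [Fin.sum_univ_castSucc]
  simp only [helmertMap, Fin.snoc_castSucc, Fin.snoc_last]
  have h1 : ∑ i, x i ^ 2 = ∑ j ∈ Finset.range (m + 2), extendZero x j ^ 2 := by
    rw [← Fin.sum_univ_eq_sum_range (fun j => extendZero x j ^ 2)]
    simp [extendZero_val]
  rw [h1, ← h, Fin.sum_univ_eq_sum_range (fun i => helmert (extendZero x) (m + 1 - i) ^ 2),
    Finset.sum_range_succ' (fun j => helmert (extendZero x) j ^ 2), div_pow,
    sq_sqrt (by positivity)]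
  congr 1
  · rw [← Finset.sum_range_reflect]
    have h0 : helmert (extendZero x) 0 = 0 := by simp [helmert]
    rw [h0]
    simp only [ne_eq, OfNat.ofNat_ne_zero, not_false_eq_true, zero_pow, add_zero]
    refine Finset.sum_congr rfl fun j hj => ?_
    rw [Finset.mem_range] at hj
    congr 2
    omega
  · push_cast
    ring

lemma extendZero_add {k : ℕ} (x y : Fin k → ℝ) (l : ℕ) :
    extendZero (x + y) l = extendZero x l + extendZero y l := by
  unfold extendZero
  split_ifs <;> simp

lemma extendZero_smul {k : ℕ} (c : ℝ) (x : Fin k → ℝ) (l : ℕ) :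
    extendZero (c • x) l = c * extendZero x l := by
  unfold extendZero
  split_ifs <;> simp

/-- `helmertMap` as a linear map. -/
noncomputable def helmertLinear (m : ℕ) : (Fin (m + 2) → ℝ) →ₗ[ℝ] (Fin (m + 2) → ℝ) where
  toFun := helmertMap m
  map_add' x y := by
    ext i
    refine Fin.lastCases ?_ (fun j => ?_) i
    · simp only [helmertMap, Fin.snoc_last, Pi.add_apply, extendZero_add, Finset.sum_add_distrib]
      ring
    · simp only [helmertMap, Fin.snoc_castSucc, Pi.add_apply, helmert, extendZero_add,
        Finset.sum_add_distrib]
      ring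
  map_smul' c x := by
    ext i
    refine Fin.lastCases ?_ (fun j => ?_) i
    · simp only [helmertMap, Fin.snoc_last, Pi.smul_apply, extendZero_smul, ← Finset.mul_sum,
        RingHom.id_apply, smul_eq_mul]
      ring
    · simp only [helmertMap, Fin.snoc_castSucc, Pi.smul_apply, helmert, extendZero_smul,
        ← Finset.mul_sum, RingHom.id_apply, smul_eq_mul]
      ring

lemma measurePreserving_helmertMap (m : ℕ) :
    MeasurePreserving (helmertMap m) volume volume := by
  let L : EuclideanSpace ℝ (Fin (m + 2)) →ₗ[ℝ] EuclideanSpace ℝ (Fin (m + 2)) :=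
    (WithLp.linearEquiv 2 ℝ (Fin (m + 2) → ℝ)).symm.toLinearMap ∘ₗ helmertLinear m ∘ₗ
      (WithLp.linearEquiv 2 ℝ (Fin (m + 2) → ℝ)).toLinearMap
  let I : EuclideanSpace ℝ (Fin (m + 2)) →ₗᵢ[ℝ] EuclideanSpace ℝ (Fin (m + 2)) :=
    ⟨L, fun x => by
      rw [EuclideanSpace.norm_eq, EuclideanSpace.norm_eq]
      congr 1
      simp only [norm_eq_abs, sq_abs]
      exact sum_sq_helmertMap m x.ofLp⟩
  have h := (I.toLinearIsometryEquiv rfl).measurePreserving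
  exact (PiLp.volume_preserving_ofLp (Fin (m + 2))).comp
    (h.comp (PiLp.volume_preserving_toLp (Fin (m + 2))))

/-- The image of the Weyl chamber in the leading Helmert coordinates. -/
def chamberCone (m : ℕ) : Set (Fin (m + 1) → ℝ) :=
  {s | s (Fin.last m) ≤ 0 ∧
    ∀ i : Fin m, √(((m : ℝ) + 2 - i) / (m - i)) * s i.castSucc ≤ s i.succ}

lemma measurableSet_chamberCone (m : ℕ) : MeasurableSet (chamberCone m) := by
  refine MeasurableSet.inter
    (measurableSet_le (measurable_pi_apply (Fin.last m)) measurable_const) ?_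
  have : {s : Fin (m + 1) → ℝ | ∀ i : Fin m, √(((m : ℝ) + 2 - i) / (m - i)) * s i.castSucc
      ≤ s i.succ} = ⋂ i : Fin m, {s | √(((m : ℝ) + 2 - i) / (m - i)) * s i.castSucc
      ≤ s i.succ} := by
    ext; simp
  change MeasurableSet {s : Fin (m + 1) → ℝ | ∀ i : Fin m, _}
  rw [this]
  exact MeasurableSet.iInter fun i => measurableSet_le (by fun_prop) (by fun_prop)

lemma smul_mem_chamberCone {m : ℕ} {c : ℝ} (hc : 0 < c) (s : Fin (m + 1) → ℝ) :
    c • s ∈ chamberCone m ↔ s ∈ chamberCone m := by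
  simp only [chamberCone, Set.mem_ofPred_eq, Pi.smul_apply, smul_eq_mul]
  refine and_congr ?_ (forall_congr' fun i => ?_)
  · rw [← neg_nonneg, ← mul_neg, mul_nonneg_iff_of_pos_left hc, neg_nonneg]
  · rw [mul_left_comm, mul_le_mul_iff_right₀ hc]

lemma init_helmertMap_mem_chamberCone {m : ℕ} (x : Fin (m + 2) → ℝ) :
    (fun i : Fin (m + 1) => helmertMap m x i.castSucc) ∈ chamberCone m ↔ Monotone x := by
  rw [Fin.monotone_iff_le_succ]
  have hx : ∀ (j : ℕ) (hj : j < m + 2), extendZero x j = x ⟨j, hj⟩ := fun j hj => by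
    simp [extendZero, hj]
  have key : ∀ i : Fin m, (√(((m : ℝ) + 2 - i) / (m - i)) *
      helmert (extendZero x) (m + 1 - i) ≤ helmert (extendZero x) (m + 1 - (i + 1)) ↔
      extendZero x (m - i) ≤ extendZero x (m - i + 1)) := by
    intro i
    have hi := i.isLt
    have hj : 0 < m - (i : ℕ) := by omega
    have h := helmert_succ_le (extendZero x) hj
    have e1 : m + 1 - (i : ℕ) = m - i + 1 := by omega
    have e2 : m + 1 - ((i : ℕ) + 1) = m - i := by omega
    rw [e1, e2, ← h, Nat.cast_sub hi.le]
    have e3 : (m : ℝ) + 2 - i = m - i + 2 := by ring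
    rw [e3]
  simp only [chamberCone, helmertMap, Set.mem_ofPred_eq, Fin.snoc_castSucc, Fin.val_last,
    Fin.val_succ, Fin.val_castSucc]
  have e4 : m + 1 - m = 1 := by omega
  rw [e4, helmert_one_nonpos]
  simp only [key]
  constructor
  · rintro ⟨h0, h1⟩ j
    rcases Nat.eq_zero_or_pos (j : ℕ) with hj | hj
    · have : j = 0 := Fin.ext hj
      subst this
      rw [hx 0 (by omega), hx 1 (by omega)] at h0
      exact h0
    · have hjm := j.isLt
      have h := h1 ⟨m - j, by omega⟩
      have e : m - (m - (j : ℕ)) = j := by omega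
      simp only [e] at h
      rw [hx _ (by omega), hx _ (by omega)] at h
      exact h
  · intro h
    refine ⟨?_, fun i => ?_⟩
    · rw [hx 0 (by omega), hx 1 (by omega)]
      exact h 0
    · rw [hx _ (by omega), hx _ (by omega)]
      exact h ⟨m - i, by omega⟩

lemma factorial_mul_lintegral_chamberCone (m : ℕ) :
    ((m + 2).factorial : ℝ≥0∞) * ∫⁻ s in chamberCone m, gaussWeight s =
      ENNReal.ofReal √π ^ (m + 1) := by
  have hK := measurableSet_monotone (m + 2)
  have hD := measurableSet_chamberCone m
  have hproj : Measurable fun (y : Fin (m + 2) → ℝ) (i : Fin (m + 1)) => y i.castSucc := by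
    fun_prop
  set D' : Set (Fin (m + 2) → ℝ) := {y | (fun i : Fin (m + 1) => y i.castSucc) ∈ chamberCone m}
    with hD'
  have hD'm : MeasurableSet D' := hproj hD
  have h1 : ∫⁻ x in {x : Fin (m + 2) → ℝ | Monotone x}, gaussWeight x =
      ENNReal.ofReal √π * ∫⁻ s in chamberCone m, gaussWeight s := by
    have hF : Measurable (D'.indicator gaussWeight) := measurable_gaussWeight.indicator hD'm
    rw [← lintegral_indicator hK, ← lintegral_indicator hD]
    calc ∫⁻ x, {x : Fin (m + 2) → ℝ | Monotone x}.indicator gaussWeight x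
        = ∫⁻ x, D'.indicator gaussWeight (helmertMap m x) := by
          refine lintegral_congr fun x => ?_
          have hg : gaussWeight (helmertMap m x) = gaussWeight x := by
            unfold gaussWeight
            rw [sum_sq_helmertMap]
          have hmem : helmertMap m x ∈ D' ↔ Monotone x := init_helmertMap_mem_chamberCone x
          by_cases h : Monotone x
          · rw [Set.indicator_of_mem (show x ∈ {x : Fin (m + 2) → ℝ | Monotone x} from h),
              Set.indicator_of_mem (hmem.2 h), hg]
          · rw [Set.indicator_of_notMem (show x ∉ {x : Fin (m + 2) → ℝ | Monotone x} from h),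
              Set.indicator_of_notMem (fun h' => h (hmem.1 h'))]
      _ = ∫⁻ y, D'.indicator gaussWeight y := (measurePreserving_helmertMap m).lintegral_comp hF
      _ = ∫⁻ a : ℝ, ∫⁻ s : Fin (m + 1) → ℝ, ENNReal.ofReal (exp (-a ^ 2)) *
            (chamberCone m).indicator gaussWeight s := by
          rw [lintegral_eq_lintegral_snoc hF]
          refine lintegral_congr fun a => lintegral_congr fun s => ?_
          have hmem : (Fin.snoc s a : Fin (m + 2) → ℝ) ∈ D' ↔ s ∈ chamberCone m := by
            simp [hD']
          by_cases h : s ∈ chamberCone m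
          · rw [Set.indicator_of_mem h, Set.indicator_of_mem (hmem.2 h), gaussWeight_snoc]
          · rw [Set.indicator_of_notMem h, Set.indicator_of_notMem (fun h' => h (hmem.1 h')),
              mul_zero]
      _ = _ := by
          have hm := (measurable_gaussWeight (k := m + 1)).indicator hD
          simp_rw [lintegral_const_mul _ hm]
          rw [lintegral_mul_const _ (by fun_prop), lintegral_exp_neg_sq]
  have h2 := factorial_mul_lintegral_monotone (m + 2)
  rw [h1, mul_left_comm, pow_succ' _ (m + 1)] at h2
  have hπ : 0 < √π := sqrt_pos.2 pi_pos
  exact (ENNReal.mul_right_inj (ENNReal.ofReal_pos.2 hπ).ne' ENNReal.ofReal_ne_top).1 h2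

/-- The slice of `chamberCone` at height `-1`. -/
def chamberSlice (m : ℕ) : Set (Fin m → ℝ) :=
  {w | (Fin.snoc w (-1) : Fin (m + 1) → ℝ) ∈ chamberCone m}

lemma measurableSet_chamberSlice (m : ℕ) : MeasurableSet (chamberSlice m) :=
  (measurable_snoc.comp (measurable_const.prodMk measurable_id)) (measurableSet_chamberCone m)

lemma smul_snoc {m : ℕ} (c a : ℝ) (w : Fin m → ℝ) :
    (Fin.snoc (c • w) (c * a) : Fin (m + 1) → ℝ) = c • (Fin.snoc w a : Fin (m + 1) → ℝ) := by
  ext i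
  refine Fin.lastCases ?_ (fun j => ?_) i <;> simp

lemma lintegral_eq_lintegral_smul {m : ℕ} {u : ℝ} (hu : 0 < u) {F : (Fin m → ℝ) → ℝ≥0∞}
    (hF : Measurable F) : ∫⁻ t, F t = ENNReal.ofReal (u ^ m) * ∫⁻ w, F (u • w) := by
  have h := Measure.map_addHaar_smul (volume : Measure (Fin m → ℝ)) hu.ne'
  have h1 : ∫⁻ w, F (u • w) = ∫⁻ t, F t ∂(Measure.map (fun w : Fin m → ℝ => u • w) volume) :=
    (lintegral_map hF (measurable_const_smul u)).symm
  rw [h1, h, lintegral_smul_measure, smul_eq_mul, ← mul_assoc,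
    ← ENNReal.ofReal_mul (by positivity), abs_of_pos (by simp; positivity)]
  simp [hu.ne']

lemma lintegral_pow_mul_exp {m : ℕ} {b : ℝ} (hb : 0 < b) :
    ∫⁻ u in Set.Ioi (0 : ℝ), ENNReal.ofReal (u ^ m * exp (-b * u ^ 2)) =
      ENNReal.ofReal (Gamma (((m : ℝ) + 1) / 2) / 2 * b ^ (-((m : ℝ) + 1) / 2)) := by
  have h := integral_rpow_mul_exp_neg_mul_rpow (p := 2) (q := m) (b := b) two_pos
    (by linarith [(Nat.cast_nonneg m : (0 : ℝ) ≤ m)]) hb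
  simp only [rpow_natCast, rpow_two] at h
  have hpos : 0 < b ^ (-((m : ℝ) + 1) / 2) * (1 / 2) * Gamma (((m : ℝ) + 1) / 2) := by
    have := Gamma_pos_of_pos (show 0 < ((m : ℝ) + 1) / 2 by positivity)
    positivity
  rw [← ofReal_integral_eq_lintegral_ofReal]
  · rw [h]
    congr 1
    ring
  · exact Integrable.of_integral_ne_zero (h ▸ hpos.ne')
  · filter_upwards [ae_restrict_mem measurableSet_Ioi] with u hu
    have : 0 < u := hu
    positivity

lemma lintegral_chamberCone_eq (m : ℕ) :
    ∫⁻ s in chamberCone m, gaussWeight s =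
      ENNReal.ofReal (Gamma (((m : ℝ) + 1) / 2) / 2) *
        ∫⁻ w in chamberSlice m, ENNReal.ofReal ((1 + ∑ i, w i ^ 2) ^ (-((m : ℝ) + 1) / 2)) := by
  have hD := measurableSet_chamberCone m
  have hW := measurableSet_chamberSlice m
  have hF : Measurable ((chamberCone m).indicator gaussWeight) :=
    measurable_gaussWeight.indicator hD
  set H : ℝ → ℝ≥0∞ := fun a => ∫⁻ t : Fin m → ℝ,
    (chamberCone m).indicator gaussWeight (Fin.snoc t a) with hH
  have hzero : ∀ u : ℝ, u < 0 → H (-u) = 0 := by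
    intro u hu
    rw [hH]
    refine (lintegral_congr fun t => ?_).trans lintegral_zero
    refine Set.indicator_of_notMem (fun h => ?_) _
    have := h.1
    rw [Fin.snoc_last] at this
    linarith
  have hpos : ∀ u : ℝ, 0 < u → H (-u) = ∫⁻ w in chamberSlice m,
      ENNReal.ofReal (u ^ m * exp (-(1 + ∑ i, w i ^ 2) * u ^ 2)) := by
    intro u hu
    have hm : Measurable fun t : Fin m → ℝ =>
        (chamberCone m).indicator gaussWeight (Fin.snoc t (-u) : Fin (m + 1) → ℝ) :=
      hF.comp (measurable_snoc.comp (measurable_const.prodMk measurable_id))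
    have hu0 : 0 ≤ u ^ m := by positivity
    simp only [hH]
    rw [lintegral_eq_lintegral_smul hu hm]
    simp only [ENNReal.ofReal_mul hu0]
    rw [lintegral_const_mul _ (by fun_prop), ← lintegral_indicator hW]
    congr 1
    refine lintegral_congr fun w => ?_
    have e : (Fin.snoc (u • w) (-u) : Fin (m + 1) → ℝ) =
        u • (Fin.snoc w (-1) : Fin (m + 1) → ℝ) := by
      rw [← smul_snoc, mul_neg_one]
    have hmem : (Fin.snoc (u • w) (-u) : Fin (m + 1) → ℝ) ∈ chamberCone m ↔
        w ∈ chamberSlice m := by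
      rw [e, smul_mem_chamberCone hu]
      rfl
    by_cases h : w ∈ chamberSlice m
    · rw [Set.indicator_of_mem h, Set.indicator_of_mem (hmem.2 h), e]
      unfold gaussWeight
      congr 2
      rw [Fin.sum_univ_castSucc]
      simp only [Pi.smul_apply, smul_eq_mul, Fin.snoc_castSucc, Fin.snoc_last, mul_pow,
        ← Finset.mul_sum]
      ring
    · rw [Set.indicator_of_notMem h, Set.indicator_of_notMem (fun h' => h (hmem.1 h'))]
  have hjoint : Measurable fun p : ℝ × (Fin m → ℝ) =>
      ENNReal.ofReal (p.1 ^ m * exp (-(1 + ∑ i, p.2 i ^ 2) * p.1 ^ 2)) := by fun_prop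
  have hHm : Measurable H := by
    have := (hF.comp (measurable_snoc (k := m))).lintegral_prod_right'
      (ν := (volume : Measure (Fin m → ℝ)))
    exact this
  calc ∫⁻ s in chamberCone m, gaussWeight s
      = ∫⁻ a, H a := by rw [← lintegral_indicator hD, lintegral_eq_lintegral_snoc hF]
    _ = ∫⁻ u, H (-u) := ((Measure.measurePreserving_neg (volume : Measure ℝ)).lintegral_comp
          hHm).symm
    _ = ∫⁻ u in Set.Ici (0 : ℝ), H (-u) := by
        rw [← lintegral_indicator measurableSet_Ici]
        refine lintegral_congr fun u => ?_
        by_cases hu : u ∈ Set.Ici (0 : ℝ)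
        · rw [Set.indicator_of_mem hu]
        · rw [Set.indicator_of_notMem hu, hzero u (not_le.1 hu)]
    _ = ∫⁻ u in Set.Ioi (0 : ℝ), H (-u) := setLIntegral_congr Ioi_ae_eq_Ici.symm
    _ = ∫⁻ u in Set.Ioi (0 : ℝ), ∫⁻ w in chamberSlice m,
          ENNReal.ofReal (u ^ m * exp (-(1 + ∑ i, w i ^ 2) * u ^ 2)) :=
        setLIntegral_congr_fun measurableSet_Ioi fun u hu => hpos u hu
    _ = ∫⁻ w in chamberSlice m, ∫⁻ u in Set.Ioi (0 : ℝ),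
          ENNReal.ofReal (u ^ m * exp (-(1 + ∑ i, w i ^ 2) * u ^ 2)) :=
        lintegral_lintegral_swap hjoint.aemeasurable
    _ = _ := by
        have hΓ : 0 ≤ Gamma (((m : ℝ) + 1) / 2) / 2 := by
          have := Gamma_pos_of_pos (show 0 < ((m : ℝ) + 1) / 2 by positivity)
          positivity
        rw [← lintegral_const_mul _ (by fun_prop)]
        refine lintegral_congr fun w => ?_
        rw [lintegral_pow_mul_exp (by positivity), ENNReal.ofReal_mul hΓ]

/-- The preimage of `chamberSlice` under the central projection of the lower hemisphere. -/
def chamberBall (m : ℕ) : Set (Fin m → ℝ) :=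
  {t | 0 < 1 - ∑ i, t i ^ 2 ∧
    (Fin.snoc t (-√(1 - ∑ i, t i ^ 2)) : Fin (m + 1) → ℝ) ∈ chamberCone m}

lemma measurableSet_chamberBall (m : ℕ) : MeasurableSet (chamberBall m) := by
  have hg : Measurable fun t : Fin m → ℝ => 1 - ∑ i, t i ^ 2 := by fun_prop
  refine MeasurableSet.inter (measurableSet_lt measurable_const hg) ?_
  have h : Measurable fun t : Fin m → ℝ =>
      (Fin.snoc t (-√(1 - ∑ i, t i ^ 2)) : Fin (m + 1) → ℝ) :=
    measurable_snoc.comp (Measurable.prodMk (by fun_prop) measurable_id)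
  exact h (measurableSet_chamberCone m)

/-- Central projection of the unit ball, seen as a hemisphere, onto its tangent hyperplane. -/
noncomputable def centralProj {m : ℕ} (t : Fin m → ℝ) : Fin m → ℝ :=
  (√(1 - ∑ i, t i ^ 2))⁻¹ • t

lemma sum_sq_smul {m : ℕ} (c : ℝ) (t : Fin m → ℝ) :
    ∑ i, (c • t) i ^ 2 = c ^ 2 * ∑ i, t i ^ 2 := by
  simp [mul_pow, Finset.mul_sum]

lemma one_add_sum_sq_centralProj {m : ℕ} {t : Fin m → ℝ} (ht : 0 < 1 - ∑ i, t i ^ 2) :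
    1 + ∑ i, centralProj t i ^ 2 = (1 - ∑ i, t i ^ 2)⁻¹ := by
  rw [centralProj, sum_sq_smul, inv_pow, sq_sqrt ht.le]
  field_simp
  ring

lemma sqrt_smul_centralProj {m : ℕ} {t : Fin m → ℝ} (ht : 0 < 1 - ∑ i, t i ^ 2) :
    √(1 + ∑ i, centralProj t i ^ 2)⁻¹ • centralProj t = t := by
  have : √(1 - ∑ i, t i ^ 2) ≠ 0 := (sqrt_pos.2 ht).ne'
  rw [one_add_sum_sq_centralProj ht, inv_inv, centralProj, smul_smul, mul_inv_cancel₀ this,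
    one_smul]

lemma injOn_centralProj (m : ℕ) : Set.InjOn centralProj (chamberBall m) := by
  intro t ht t' ht' h
  rw [← sqrt_smul_centralProj ht.1, h, sqrt_smul_centralProj ht'.1]

lemma centralProj_mem_chamberSlice {m : ℕ} {t : Fin m → ℝ} (ht : 0 < 1 - ∑ i, t i ^ 2) :
    centralProj t ∈ chamberSlice m ↔ t ∈ chamberBall m := by
  have hs := sqrt_pos.2 ht
  have e : (Fin.snoc (centralProj t) (-1) : Fin (m + 1) → ℝ) =
      (√(1 - ∑ i, t i ^ 2))⁻¹ • (Fin.snoc t (-√(1 - ∑ i, t i ^ 2)) : Fin (m + 1) → ℝ) := by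
    rw [← smul_snoc, mul_neg, inv_mul_cancel₀ hs.ne', centralProj]
  change _ ∈ chamberCone m ↔ _ ∧ _
  rw [e, smul_mem_chamberCone (inv_pos.2 hs)]
  exact ⟨fun h => ⟨ht, h⟩, fun h => h.2⟩

lemma image_centralProj (m : ℕ) : centralProj '' chamberBall m = chamberSlice m := by
  ext w
  constructor
  · rintro ⟨t, ht, rfl⟩
    exact (centralProj_mem_chamberSlice ht.1).2 ht
  · intro hw
    have hpos : 0 < 1 + ∑ i, w i ^ 2 := by positivity
    set t : Fin m → ℝ := √(1 + ∑ i, w i ^ 2)⁻¹ • w with htdef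
    have hg : 1 - ∑ i, t i ^ 2 = (1 + ∑ i, w i ^ 2)⁻¹ := by
      rw [htdef, sum_sq_smul, sq_sqrt (by positivity)]
      field_simp
      ring
    have ht : 0 < 1 - ∑ i, t i ^ 2 := by rw [hg]; positivity
    have hproj : centralProj t = w := by
      have : √(1 + ∑ i, w i ^ 2)⁻¹ ≠ 0 := by positivity
      rw [centralProj, hg, htdef, smul_smul, inv_mul_cancel₀ this, one_smul]
    exact ⟨t, (centralProj_mem_chamberSlice ht).1 (hproj ▸ hw), hproj⟩

/-- The derivative of `centralProj`. -/
noncomputable def centralProjDeriv {m : ℕ} (t : Fin m → ℝ) : (Fin m → ℝ) →L[ℝ] (Fin m → ℝ) :=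
  (√(1 - ∑ i, t i ^ 2))⁻¹ • (ContinuousLinearMap.id ℝ (Fin m → ℝ) +
    ((1 - ∑ i, t i ^ 2)⁻¹ • ∑ i, t i • ContinuousLinearMap.proj (R := ℝ)
      (φ := fun _ : Fin m => ℝ) i).smulRight t)

lemma hasFDerivAt_centralProj {m : ℕ} {t : Fin m → ℝ} (ht : 0 < 1 - ∑ i, t i ^ 2) :
    HasFDerivAt centralProj (centralProjDeriv t) t := by
  have hs := sqrt_pos.2 ht
  have h1 : HasFDerivAt (fun t : Fin m → ℝ => ∑ i, t i ^ 2)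
      (∑ i, (2 * t i) • ContinuousLinearMap.proj (R := ℝ) (φ := fun _ : Fin m => ℝ) i) t := by
    refine HasFDerivAt.fun_sum fun i _ => ?_
    simpa using (hasFDerivAt_apply (𝕜 := ℝ) (F' := fun _ : Fin m => ℝ) i t).pow 2
  have h2 := h1.const_sub 1
  have h3 := ((hasDerivAt_sqrt ht.ne').fun_inv hs.ne').comp_hasFDerivAt t h2
  have h4 := h3.smul (hasFDerivAt_id t)
  refine h4.congr_fderiv ?_
  ext v i
  simp only [centralProjDeriv, sq_sqrt ht.le]
  simp only [add_apply, smul_apply,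
    ContinuousLinearMap.smulRight_apply, neg_apply,
    sum_apply, ContinuousLinearMap.proj_apply, ContinuousLinearMap.id_apply,
    Pi.add_apply, Pi.smul_apply, smul_eq_mul, Function.comp_apply, id_eq, mul_assoc,
    ← Finset.mul_sum]
  field_simp

lemma det_centralProjDeriv {m : ℕ} {t : Fin m → ℝ} (ht : 0 < 1 - ∑ i, t i ^ 2) :
    (centralProjDeriv t).det = (√(1 - ∑ i, t i ^ 2))⁻¹ ^ m * (1 - ∑ i, t i ^ 2)⁻¹ := by
  have e : ((centralProjDeriv t : (Fin m → ℝ) →L[ℝ] (Fin m → ℝ)) :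
      (Fin m → ℝ) →ₗ[ℝ] (Fin m → ℝ)) = (√(1 - ∑ i, t i ^ 2))⁻¹ •
        LinearMap.transvection ((1 - ∑ i, t i ^ 2)⁻¹ • ∑ i, t i • LinearMap.proj (R := ℝ)
          (φ := fun _ : Fin m => ℝ) i) t := by
    ext v i
    simp [centralProjDeriv, LinearMap.transvection]
    ring
  rw [ContinuousLinearMap.det, e, LinearMap.det_smul, LinearMap.transvection.det]
  simp only [Module.finrank_fin_fun, LinearMap.smul_apply, LinearMap.sum_apply,
    LinearMap.proj_apply, smul_eq_mul, ← sq]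
  congr 1
  field_simp
  ring

lemma lintegral_chamberSlice_eq (m : ℕ) :
    ∫⁻ w in chamberSlice m, ENNReal.ofReal ((1 + ∑ i, w i ^ 2) ^ (-((m : ℝ) + 1) / 2)) =
      ∫⁻ t in chamberBall m, ENNReal.ofReal (√(1 - ∑ i, t i ^ 2))⁻¹ := by
  rw [← image_centralProj, lintegral_image_eq_lintegral_abs_det_fderiv_mul volume
    (measurableSet_chamberBall m)
    (fun t ht => (hasFDerivAt_centralProj ht.1).hasFDerivWithinAt) (injOn_centralProj m)]
  refine setLIntegral_congr_fun (measurableSet_chamberBall m) fun t ht => ?_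
  have hg : 0 < 1 - ∑ i, t i ^ 2 := ht.1
  have hs := sqrt_pos.2 hg
  simp only [det_centralProjDeriv hg, one_add_sum_sq_centralProj hg]
  rw [← ENNReal.ofReal_mul (abs_nonneg _), abs_of_pos (by positivity)]
  congr 1
  have e : ((1 - ∑ i, t i ^ 2)⁻¹) ^ (-((m : ℝ) + 1) / 2) = √(1 - ∑ i, t i ^ 2) ^ (m + 1) := by
    rw [inv_rpow hg.le, ← rpow_neg hg.le, sqrt_eq_rpow, ← rpow_natCast, ← rpow_mul hg.le]
    congr 1
    push_cast
    ring
  rw [e]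
  nth_rewrite 2 [← sq_sqrt hg.le]
  rw [inv_pow]
  field_simp
  ring

lemma factorial_mul_lintegral_chamberBall (m : ℕ) :
    ((m + 2).factorial : ℝ≥0∞) * (ENNReal.ofReal (Gamma (((m : ℝ) + 1) / 2) / 2) *
      ∫⁻ t in chamberBall m, ENNReal.ofReal (√(1 - ∑ i, t i ^ 2))⁻¹) =
      ENNReal.ofReal √π ^ (m + 1) := by
  rw [← lintegral_chamberSlice_eq, ← lintegral_chamberCone_eq,
    factorial_mul_lintegral_chamberCone]

lemma le_neg_sqrt_div_of_sqrt_mul_le {c x G y : ℝ} (hc : 0 < c) (hG : 0 ≤ G - x ^ 2)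
    (hy : y ≤ -√(G - x ^ 2) / c) (h : √((c + 2) / c) * x ≤ y) : x ≤ -√G / (c + 1) := by
  have hr : 0 < √((c + 2) / c) := by positivity
  have h0 : √((c + 2) / c) * (-x) ≥ √(G - x ^ 2) / c := by
    have := h.trans hy
    rw [neg_div] at this
    linarith
  have hx : 0 ≤ -x := by
    by_contra hneg
    have h1 : √((c + 2) / c) * (-x) < 0 := mul_neg_of_pos_of_neg hr (not_le.1 hneg)
    have h2 : 0 ≤ √(G - x ^ 2) / c := by positivity
    linarith
  have hsq : (√(G - x ^ 2) / c) ^ 2 ≤ (√((c + 2) / c) * (-x)) ^ 2 :=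
    pow_le_pow_left₀ (by positivity) h0 2
  rw [div_pow, mul_pow, sq_sqrt hG, sq_sqrt (by positivity)] at hsq
  have hsq' : G - x ^ 2 ≤ c * (c + 2) * x ^ 2 := by
    have := mul_le_mul_of_nonneg_right hsq (sq_nonneg c)
    field_simp at this
    linarith
  have hle : √G ≤ (c + 1) * (-x) := by
    rw [sqrt_le_left (by positivity)]
    nlinarith
  rw [le_div_iff₀ (by linarith)]
  linarith

section Sequences

variable {m : ℕ} {T G : ℕ → ℝ}

lemma nonneg_of_bounds (h0 : G 0 = 1) (hG : ∀ k < m, G (k + 1) = G k - T k ^ 2)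
    (hB : ∀ i < m, -√(G i) ≤ T i ∧ T i ≤ -√(G i) / ((m : ℝ) + 1 - i)) :
    ∀ k ≤ m, 0 ≤ G k := by
  intro k
  induction k with
  | zero => simp [h0]
  | succ k ih =>
    intro hk
    have hGk := ih (by omega)
    obtain ⟨h1, h2⟩ := hB k (by omega)
    have hkm : (k : ℝ) + 1 ≤ m := by exact_mod_cast hk
    have h3 : -√(G k) / ((m : ℝ) + 1 - k) ≤ 0 :=
      div_nonpos_of_nonpos_of_nonneg (by simp) (by linarith)
    rw [hG k hk]
    nlinarith [sq_sqrt hGk, sqrt_nonneg (G k)]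

lemma upper_bounds_of_ratio_bounds (hm : 0 < m) (hG : ∀ k < m, G (k + 1) = G k - T k ^ 2)
    (hpos : ∀ k ≤ m, 0 ≤ G k)
    (hr : ∀ j, j + 1 < m → √(((m : ℝ) + 2 - j) / (m - j)) * T j ≤ T (j + 1))
    (hlast : √3 * T (m - 1) ≤ -√(G m)) :
    ∀ j < m, T j ≤ -√(G j) / ((m : ℝ) + 1 - j) := by
  have key : ∀ d < m, T (m - 1 - d) ≤ -√(G (m - 1 - d)) / ((m : ℝ) + 1 - (m - 1 - d : ℕ)) := by
    intro d
    induction d with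
    | zero =>
      intro _
      have e := hG (m - 1) (by omega)
      rw [Nat.sub_add_cancel hm] at e
      have hp := hpos m le_rfl
      rw [e] at hp hlast
      have h := le_neg_sqrt_div_of_sqrt_mul_le (c := 1) one_pos hp (by rw [div_one])
        (by norm_num; exact hlast)
      rw [Nat.sub_zero, Nat.cast_sub hm]
      convert h using 2
      push_cast
      ring
    | succ d ih =>
      intro hd
      have ih' := ih (by omega)
      obtain ⟨j, hj⟩ : ∃ j, j = m - 1 - (d + 1) := ⟨_, rfl⟩
      have e1 : m - 1 - d = j + 1 := by omega
      rw [← hj]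
      rw [e1, hG j (by omega)] at ih'
      have hjm : (j : ℝ) + 1 < m := by exact_mod_cast (show j + 1 < m by omega)
      have hp := hpos (j + 1) (by omega)
      rw [hG j (by omega)] at hp
      have hrj := hr j (by omega)
      have e2 : (m : ℝ) + 2 - j = m - j + 2 := by ring
      rw [e2] at hrj
      have e3 : (m : ℝ) + 1 - (j + 1 : ℕ) = m - j := by push_cast; ring
      rw [e3] at ih'
      have h := le_neg_sqrt_div_of_sqrt_mul_le (by linarith) hp ih' hrj
      rwa [show (m : ℝ) + 1 - j = m - j + 1 by ring]
  intro j hj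
  have h := key (m - 1 - j) (by omega)
  rwa [show m - 1 - (m - 1 - j) = j by omega] at h

lemma sqrt_three_mul_le (hm : 0 < m) (hG : ∀ k < m, G (k + 1) = G k - T k ^ 2)
    (hB : ∀ i < m, -√(G i) ≤ T i ∧ T i ≤ -√(G i) / ((m : ℝ) + 1 - i)) :
    √3 * T (m - 1) ≤ -√(G m) := by
  have h := (hB (m - 1) (by omega)).2
  have e := hG (m - 1) (by omega)
  rw [Nat.sub_add_cancel hm] at e
  have e2 : (m : ℝ) + 1 - (m - 1 : ℕ) = 2 := by
    rw [Nat.cast_sub hm]; push_cast; ring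
  rw [e2] at h
  have hx : √(G (m - 1)) ≤ -2 * T (m - 1) := by linarith
  have h0 : 0 ≤ -T (m - 1) := by linarith [sqrt_nonneg (G (m - 1))]
  have h1 : G (m - 1) ≤ (-2 * T (m - 1)) ^ 2 := (sqrt_le_left (by linarith)).1 hx
  have h2 : √(G m) ≤ √3 * (-T (m - 1)) := by
    rw [sqrt_le_left (by positivity), mul_pow, sq_sqrt (by norm_num), e]
    linarith
  linarith

end Sequences

lemma gfun_zero {m : ℕ} (t : Fin m → ℝ) : gfun t 0 = 1 := by simp [gfun]

lemma gfun_succ {m : ℕ} (t : Fin m → ℝ) {k : ℕ} (hk : k < m) :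
    gfun t (k + 1) = gfun t k - extendZero t k ^ 2 := by
  have h : ∀ j : Fin m, (if (j : ℕ) < k + 1 then t j ^ 2 else 0) =
      (if (j : ℕ) < k then t j ^ 2 else 0) + if j = ⟨k, hk⟩ then t j ^ 2 else 0 := by
    intro j
    rcases lt_trichotomy (j : ℕ) k with h | h | h
    · simp [h, Nat.lt_succ_of_lt h, Fin.ext_iff, h.ne]
    · simp [Fin.ext_iff, h]
    · simp [Fin.ext_iff, h.ne', not_lt_of_gt h, show ¬ (j : ℕ) < k + 1 by omega]
  simp only [gfun, h, Finset.sum_add_distrib, Finset.sum_ite_eq', Finset.mem_univ, if_true,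
    extendZero, hk, dif_pos]
  ring

lemma gfun_self {m : ℕ} (t : Fin m → ℝ) : gfun t m = 1 - ∑ i, t i ^ 2 := by
  simp [gfun]

lemma gfun_anti {m : ℕ} (t : Fin m → ℝ) {k : ℕ} (hk : k ≤ m) : gfun t m ≤ gfun t k := by
  induction hk using Nat.decreasingInduction with
  | of_succ k hk ih =>
    rw [gfun_succ t hk] at ih
    linarith [sq_nonneg (extendZero t k)]
  | self => rfl

/-- `Bset (m + 2)` as a set of tuples indexed by `Fin m`. -/
noncomputable def shiftedBset (m : ℕ) : Set (Fin m → ℝ) := Bset (m + 2)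

lemma mem_shiftedBset_iff {m : ℕ} (t : Fin m → ℝ) :
    t ∈ shiftedBset m ↔
      (∀ i < m, -√(gfun t i) ≤ extendZero t i ∧
        extendZero t i ≤ -√(gfun t i) / ((m : ℝ) + 1 - i)) ∧
      ∀ j, j + 1 < m → √(((m : ℝ) + 2 - j) / (m - j)) * extendZero t j ≤
        extendZero t (j + 1) := by
  have hx : ∀ (j : ℕ) (hj : j < m), extendZero t j = t ⟨j, hj⟩ := fun j hj => by
    simp [extendZero, hj]
  have hB : t ∈ shiftedBset m ↔ ∀ i : Fin m,
      ((i : ℕ) = 0 → -1 ≤ t i ∧ t i ≤ -1 / (((m + 2 : ℕ) : ℝ) - 1)) ∧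
      (1 ≤ (i : ℕ) →
      max (√((((m + 2 : ℕ) : ℝ) - ((i : ℕ) + 1) + 2) / (((m + 2 : ℕ) : ℝ) - ((i : ℕ) + 1))) *
            t ⟨(i : ℕ) - 1, lt_of_le_of_lt (Nat.sub_le _ _) i.isLt⟩)
          (-(√(gfun t (i : ℕ)))) ≤ t i ∧
      t i ≤ -(√(gfun t (i : ℕ))) / (((m + 2 : ℕ) : ℝ) - ((i : ℕ) + 1))) := Iff.rfl
  rw [hB]
  constructor
  · intro h
    refine ⟨fun i hi => ?_, fun j hj => ?_⟩
    · have h' := h ⟨i, hi⟩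
      rw [hx i hi]
      rcases Nat.eq_zero_or_pos i with rfl | hpos
      · have := h'.1 rfl
        rw [gfun_zero, sqrt_one]
        convert this using 3
        push_cast
        ring
      · have := h'.2 hpos
        refine ⟨(le_max_right _ _).trans this.1, ?_⟩
        convert this.2 using 2
        push_cast
        ring
    · have h' := ((le_max_left _ _).trans ((h ⟨j + 1, hj⟩).2 (by simp)).1)
      have e1 : ((m + 2 : ℕ) : ℝ) - ((j + 1 : ℕ) + 1) + 2 = m + 2 - j := by push_cast; ring
      have e2 : ((m + 2 : ℕ) : ℝ) - ((j + 1 : ℕ) + 1) = m - j := by push_cast; ring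
      rw [hx _ hj, hx j (by omega), ← e1, ← e2]
      exact h'
  · rintro ⟨h1, h2⟩ ⟨i, hi⟩
    refine ⟨fun h0 => ?_, fun hpos => ?_⟩
    · have h := h1 i hi
      rw [hx i hi] at h
      have h0' : i = 0 := h0
      subst h0'
      rw [gfun_zero, sqrt_one] at h
      convert h using 3
      push_cast
      ring
    · have h := h1 i hi
      rw [hx i hi] at h
      obtain ⟨j, rfl⟩ : ∃ j, i = j + 1 := ⟨i - 1, by have : 1 ≤ i := hpos; omega⟩
      have h' := h2 j hi
      have e1 : ((m + 2 : ℕ) : ℝ) - ((j + 1 : ℕ) + 1) + 2 = m + 2 - j := by push_cast; ring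
      have e2 : ((m + 2 : ℕ) : ℝ) - ((j + 1 : ℕ) + 1) = m - j := by push_cast; ring
      rw [hx _ hi, hx j (by omega), ← e1, ← e2] at h'
      refine ⟨max_le ?_ h.1, ?_⟩
      · exact h'
      · convert h.2 using 2
        push_cast
        ring

lemma mem_chamberBall_iff {m : ℕ} (hm : 0 < m) (t : Fin m → ℝ) :
    t ∈ chamberBall m ↔ 0 < gfun t m ∧ √3 * extendZero t (m - 1) ≤ -√(gfun t m) ∧
      ∀ j, j + 1 < m → √(((m : ℝ) + 2 - j) / (m - j)) * extendZero t j ≤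
        extendZero t (j + 1) := by
  obtain ⟨p, rfl⟩ : ∃ p, m = p + 1 := ⟨m - 1, by omega⟩
  have hx : ∀ (j : ℕ) (hj : j < p + 1), extendZero t j = t ⟨j, hj⟩ := fun j hj => by
    simp [extendZero, hj]
  simp only [chamberBall, chamberCone, Set.mem_ofPred_eq, Fin.snoc_last, gfun_self,
    Fin.snoc_castSucc, Left.neg_nonpos_iff, sqrt_nonneg, true_and]
  refine and_congr_right fun _ => ?_
  rw [Fin.forall_fin_succ', and_comm]
  refine and_congr ?_ ?_
  · rw [Fin.succ_last, Fin.snoc_last, hx _ (by omega)]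
    have e : ((p + 1 : ℕ) : ℝ) + 2 - (Fin.last p : ℕ) = 3 := by
      simp only [Fin.val_last]; push_cast; ring
    have e' : ((p + 1 : ℕ) : ℝ) - (Fin.last p : ℕ) = 1 := by
      simp only [Fin.val_last]; push_cast; ring
    rw [e, e', div_one]
    rfl
  · constructor
    · intro h j hj
      have h' := h ⟨j, by omega⟩
      rw [Fin.succ_castSucc, Fin.snoc_castSucc] at h'
      rw [hx _ hj, hx j (by omega)]
      exact h'
    · intro h i
      have h' := h i (by omega)
      rw [hx (i + 1) (by omega), hx i (by omega)] at h'
      rw [Fin.succ_castSucc, Fin.snoc_castSucc]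
      exact h'

lemma mem_shiftedBset_and_pos_iff {m : ℕ} (hm : 0 < m) (t : Fin m → ℝ) :
    t ∈ shiftedBset m ∧ 0 < gfun t m ↔ t ∈ chamberBall m := by
  have h0 := gfun_zero t
  have hG : ∀ k < m, gfun t (k + 1) = gfun t k - extendZero t k ^ 2 := fun k hk => gfun_succ t hk
  rw [mem_shiftedBset_iff, mem_chamberBall_iff hm]
  constructor
  · rintro ⟨⟨h1, h2⟩, hpos⟩
    exact ⟨hpos, sqrt_three_mul_le hm hG h1, h2⟩
  · rintro ⟨hpos, h3, h2⟩
    have hnn : ∀ k ≤ m, 0 ≤ gfun t k := fun k hk => hpos.le.trans (gfun_anti t hk)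
    refine ⟨⟨fun i hi => ⟨?_, upper_bounds_of_ratio_bounds hm hG hnn h2 h3 i hi⟩, h2⟩, hpos⟩
    have h := hnn (i + 1) hi
    rw [hG i hi] at h
    exact neg_le_of_abs_le (abs_le_sqrt (by linarith))

lemma gfun_nonneg_of_mem_shiftedBset {m : ℕ} (t : Fin m → ℝ)
    (ht : t ∈ shiftedBset m) : 0 ≤ gfun t m :=
  nonneg_of_bounds (gfun_zero t) (fun _ hk => gfun_succ t hk)
    ((mem_shiftedBset_iff t).1 ht).1 m le_rfl

lemma measurable_gfun {m : ℕ} (k : ℕ) : Measurable fun t : Fin m → ℝ => gfun t k := by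
  unfold gfun
  refine measurable_const.sub (Finset.measurable_sum _ fun j _ => ?_)
  split_ifs
  · fun_prop
  · exact measurable_const

lemma measurableSet_shiftedBset (m : ℕ) : MeasurableSet (shiftedBset m) := by
  have hx : ∀ j : ℕ, Measurable fun t : Fin m → ℝ => extendZero t j := by
    intro j
    unfold extendZero
    split_ifs
    · fun_prop
    · exact measurable_const
  have e : shiftedBset m = {t | _} := Set.ext fun t => mem_shiftedBset_iff t
  rw [e]
  have hs : ∀ j, Measurable fun t : Fin m → ℝ => √(gfun t j) := fun j => (measurable_gfun j).sqrt
  refine MeasurableSet.inter ?_ ?_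
  · change MeasurableSet {t : Fin m → ℝ | ∀ i < m, _}
    simp only [Set.ofPred_forall]
    refine MeasurableSet.iInter fun i => MeasurableSet.iInter fun _ => ?_
    exact (measurableSet_le (hs i).neg (hx i)).inter
      (measurableSet_le (hx i) ((hs i).neg.div_const _))
  · change MeasurableSet {t : Fin m → ℝ | ∀ j, j + 1 < m → _}
    simp only [Set.ofPred_forall]
    refine MeasurableSet.iInter fun i => MeasurableSet.iInter fun _ => ?_
    exact measurableSet_le ((hx i).const_mul _) (hx _)

lemma setIntegral_shiftedBset_eq {m : ℕ} (hm : 0 < m) :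
    ∫ t in shiftedBset m, (√(gfun t m))⁻¹ =
      (∫⁻ t in chamberBall m, ENNReal.ofReal (√(1 - ∑ i, t i ^ 2))⁻¹).toReal := by
  have hmeas : Measurable fun t : Fin m → ℝ => (√(gfun t m))⁻¹ := (measurable_gfun m).sqrt.inv
  rw [integral_eq_lintegral_of_nonneg_ae (Filter.Eventually.of_forall fun t => by positivity)
    hmeas.aestronglyMeasurable]
  congr 1
  rw [← lintegral_indicator (measurableSet_shiftedBset m),
    ← lintegral_indicator (measurableSet_chamberBall m)]
  refine lintegral_congr fun t => ?_
  have hiff := mem_shiftedBset_and_pos_iff hm t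
  by_cases hB : t ∈ shiftedBset m
  · rw [Set.indicator_of_mem hB]
    by_cases hg : 0 < gfun t m
    · rw [Set.indicator_of_mem (hiff.1 ⟨hB, hg⟩), gfun_self]
    · rw [Set.indicator_of_notMem fun h => hg (hiff.2 h).2, sqrt_eq_zero_of_nonpos (not_lt.1 hg)]
      simp
  · rw [Set.indicator_of_notMem hB, Set.indicator_of_notMem fun h => hB (hiff.2 h).1]

lemma toReal_lintegral_chamberBall (m : ℕ) :
    (∫⁻ t in chamberBall m, ENNReal.ofReal (√(1 - ∑ i, t i ^ 2))⁻¹).toReal =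
      2 * π ^ (((m : ℝ) + 1) / 2) / ((m + 2).factorial * Gamma (((m : ℝ) + 1) / 2)) := by
  have hΓ := Gamma_pos_of_pos (show 0 < ((m : ℝ) + 1) / 2 by positivity)
  have h := congrArg ENNReal.toReal (factorial_mul_lintegral_chamberBall m)
  rw [ENNReal.toReal_mul, ENNReal.toReal_mul, ENNReal.toReal_natCast,
    ENNReal.toReal_ofReal (by positivity), ENNReal.toReal_pow,
    ENNReal.toReal_ofReal (by positivity)] at h
  have e : π ^ (((m : ℝ) + 1) / 2) = √π ^ (m + 1) := by
    rw [sqrt_eq_rpow, ← rpow_natCast, ← rpow_mul pi_pos.le]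
    congr 1
    push_cast
    ring
  rw [e, ← h]
  field_simp

theorem integral_over_Bset
    (n : ℕ) (hn : 3 ≤ n) :
    (∀ t ∈ Bset n, 0 ≤ gfun t (n - 2)) ∧
    ∫ t in Bset n, (Real.sqrt (gfun t (n - 2)))⁻¹
      = 2 * π ^ (((n : ℝ) - 1) / 2) /
          ((n.factorial : ℝ) * Real.Gamma (((n : ℝ) - 1) / 2)) := by
  obtain ⟨m, rfl⟩ : ∃ m, n = m + 2 := ⟨n - 2, by omega⟩
  refine ⟨fun t ht => gfun_nonneg_of_mem_shiftedBset t ht, ?_⟩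
  have h := (setIntegral_shiftedBset_eq (show 0 < m by omega)).trans
    (toReal_lintegral_chamberBall m)
  have e : ((m + 2 : ℕ) : ℝ) - 1 = m + 1 := by push_cast; ring
  rw [e]
  exact h
end

section
/- Let f be a positive, twice continuously differentiable probability density on (0,∞) (with f = 0 on (−∞,0]). If there is a constant c′ ∈ ℝ such that (f″(x) f(x) − (f′(x))²) x² = c′ f(x)² for all x > 0, then f is a gamma density, i.e. f(x) = x^{a−1}e^{−x/b}/(Γ(a)b^a) for x > 0, for some a > 0 and b > 0. -/
open MeasureTheory Real

theorem eqOn_const_of_hasDerivAt_zero_Ioi {g : ℝ → ℝ}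
    (hg : ∀ x, 0 < x → HasDerivAt g 0 x) : ∀ x, 0 < x → g x = g 1 := by
  intro x hx
  exact isOpen_Ioi.is_const_of_deriv_eq_zero isPreconnected_Ioi
    (fun y hy => (hg y hy).differentiableAt.differentiableWithinAt)
    (fun y hy => (hg y hy).deriv) hx (Set.mem_Ioi.2 one_pos)

/-- If `(log f)'' = c / x ^ 2` on the positive half-line, then `f` is a multiple of
`x ^ (-c) * exp (k * x)`. -/
theorem exists_eq_rpow_mul_exp_of_ode {f : ℝ → ℝ}
    (hf_pos : ∀ x, 0 < x → 0 < f x)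
    (hf_smooth : ContDiffOn ℝ 2 f (Set.Ioi 0)) {c : ℝ}
    (hode : ∀ x, 0 < x →
      (deriv (deriv f) x * f x - (deriv f x) ^ 2) * x ^ 2 = c * (f x) ^ 2) :
    ∃ k C : ℝ, 0 < C ∧ ∀ x, 0 < x → f x = C * (x ^ (-c) * exp (k * x)) := by
  have hd : ∀ x, 0 < x → HasDerivAt f (deriv f x) x := fun x hx =>
    ((hf_smooth.differentiableOn (by norm_num)).differentiableAt
      (Ioi_mem_nhds hx)).hasDerivAt
  have hdd : ∀ x, 0 < x → HasDerivAt (deriv f) (deriv (deriv f) x) x := fun x hx =>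
    (((hf_smooth.deriv_of_isOpen (m := 1) isOpen_Ioi (by norm_num)).differentiableOn
      (by norm_num)).differentiableAt (Ioi_mem_nhds hx)).hasDerivAt
  let g : ℝ → ℝ := fun x => deriv f x / f x + c * x⁻¹
  have hg := eqOn_const_of_hasDerivAt_zero_Ioi (g := g) fun x hx => by
    have hfx := (hf_pos x hx).ne'
    refine (((hdd x hx).div (hd x hx) hfx).add
      ((hasDerivAt_inv hx.ne').const_mul c)).congr_deriv ?_
    have := hode x hx
    field_simp
    linear_combination this
  let h : ℝ → ℝ := fun x => f x * (x ^ c * exp (-g 1 * x))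
  have hh := eqOn_const_of_hasDerivAt_zero_Ioi (g := h) fun x hx => by
    have hfx := (hf_pos x hx).ne'
    refine ((hd x hx).mul (((hasDerivAt_id x).rpow_const (p := c) (Or.inl hx.ne')).mul
      ((hasDerivAt_id x).const_mul (-g 1)).exp)).congr_deriv ?_
    have hgx : deriv f x / f x + c * x⁻¹ = g 1 := hg x hx
    simp only [id, Pi.mul_apply, rpow_sub_one hx.ne']
    field_simp at hgx ⊢
    linear_combination (x ^ c * exp (-(x * g 1))) * hgx
  refine ⟨g 1, h 1, mul_pos (hf_pos 1 one_pos) (by positivity), fun x hx => ?_⟩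
  rw [← hh x hx]
  have h1 : x ^ c * x ^ (-c) = 1 := by rw [← rpow_add hx]; simp
  have h2 : exp (-g 1 * x) * exp (g 1 * x) = 1 := by rw [← exp_add]; simp
  simp only [h]
  linear_combination (-f x * exp (-g 1 * x) * exp (g 1 * x)) * h1 - f x * h2

theorem neg_of_integrableOn_rpow_mul_exp {s k : ℝ}
    (h : IntegrableOn (fun x : ℝ => x ^ s * exp (k * x)) (Set.Ioi 0)) : k < 0 := by
  by_contra! hk
  refine not_integrableOn_Ioi_rpow s (Integrable.mono' h (by fun_prop) ?_)
  filter_upwards [ae_restrict_mem measurableSet_Ioi] with x (hx : 0 < x)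
  have hxs : 0 < x ^ s := rpow_pos_of_pos hx s
  rw [norm_of_nonneg hxs.le]
  exact le_mul_of_one_le_right hxs.le (one_le_exp (mul_nonneg hk hx.le))

theorem neg_one_lt_of_integrableOn_rpow_mul_exp {s k : ℝ}
    (h : IntegrableOn (fun x : ℝ => x ^ s * exp (k * x)) (Set.Ioi 0)) : -1 < s := by
  rw [← intervalIntegral.integrableOn_Ioo_rpow_iff one_pos]
  refine Integrable.mono' ((h.mono_set Set.Ioo_subset_Ioi_self).mul_const (exp |k|))
    (by fun_prop) ?_
  filter_upwards [ae_restrict_mem measurableSet_Ioo] with x hx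
  have hxs : 0 < x ^ s := rpow_pos_of_pos hx.1 s
  rw [norm_of_nonneg hxs.le, mul_assoc, ← exp_add]
  refine le_mul_of_one_le_right hxs.le (one_le_exp ?_)
  nlinarith [neg_abs_le k, abs_nonneg k, hx.1, hx.2]

theorem gamma_from_ode
    (f : ℝ → ℝ)
    (hf_pos : ∀ x, 0 < x → 0 < f x)
    (hf_zero : ∀ x, x ≤ 0 → f x = 0)
    (hf_smooth : ContDiffOn ℝ 2 f (Set.Ioi 0))
    (hf_int : ∫ x, f x = 1)
    (c' : ℝ)
    (hode : ∀ x, 0 < x →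
      (deriv (deriv f) x * f x - (deriv f x) ^ 2) * x ^ 2 = c' * (f x) ^ 2) :
    ∃ a b : ℝ, 0 < a ∧ 0 < b ∧
      ∀ x : ℝ, 0 < x →
        f x = x ^ (a - 1) * Real.exp (-x / b) / (Real.Gamma a * b ^ a) := by
  obtain ⟨k, C, hC, hf⟩ := exists_eq_rpow_mul_exp_of_ode hf_pos hf_smooth hode
  have hf_integrable : Integrable f := by
    by_contra hn
    simp [integral_undef hn] at hf_int
  have hI : IntegrableOn (fun x : ℝ => x ^ (-c') * exp (k * x)) (Set.Ioi 0) := by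
    have := (hf_integrable.integrableOn (s := Set.Ioi 0)).congr_fun
      (fun x hx => hf x hx) measurableSet_Ioi
    exact (integrable_const_mul_iff hC.ne'.isUnit _).1 this
  have hk := neg_of_integrableOn_rpow_mul_exp hI
  have hs := neg_one_lt_of_integrableOn_rpow_mul_exp hI
  have ha : 0 < 1 - c' := by linarith
  have hnk : 0 < -k := neg_pos.2 hk
  have hG : 0 < Gamma (1 - c') := Gamma_pos_of_pos ha
  have hint : C * ((1 / -k) ^ (1 - c') * Gamma (1 - c')) = 1 := by
    rw [← integral_rpow_mul_exp_neg_mul_Ioi ha hnk, ← integral_const_mul, ← hf_int,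
      ← setIntegral_eq_integral_of_forall_compl_eq_zero (s := Set.Ioi 0)
        (fun x hx => hf_zero x (not_lt.1 hx))]
    refine setIntegral_congr_fun measurableSet_Ioi fun x hx => ?_
    simp only [hf x hx]
    ring_nf
  refine ⟨1 - c', 1 / -k, ha, by positivity, fun x hx => ?_⟩
  have hb : 0 < (1 / -k) ^ (1 - c') := by positivity
  have he : -x / (1 / -k) = k * x := by rw [div_div_eq_mul_div]; ring
  rw [hf x hx, he, sub_sub_cancel_left, eq_div_iff (by positivity)]
  linear_combination (x ^ (-c') * exp (k * x)) * hint
end
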